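/- arXiv:2403.07484 — 4 statements merged into one kernel-verified Lean document; each statement's English description precedes it below -/
import Mathlib

section
/- There exists a family 𝔽 of density ideals on ω, each belonging to the class AN, with |𝔽| = 𝔡 (the dominating number), such that for every ideal I ∈ AN there is J ∈ 𝔽 with I ≤_K J. -/
open Filter Topology Set MeasureTheory
open scoped ENNReal NNReal

noncomputable section

/-- The space `N_F = ℕ ∪ {p_F}`, modelled as `Option ℕ` with `none` playing the role of `p_F`:
every natural number (i.e. `some n`) is isolated, and a set containing `none` is open iff its
trace on `ℕ` belongs to `F`. -/
def NFTop (F : Filter ℕ) : TopologicalSpace (Option ℕ) where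
  IsOpen U := none ∈ U → {n : ℕ | some n ∈ U} ∈ F
  isOpen_univ := fun _ => Filter.univ_mem
  isOpen_inter := fun U V hU hV h => Filter.inter_mem (hU h.1) (hV h.2)
  isOpen_sUnion := fun S hS h => by
    obtain ⟨U, hUS, hU⟩ := h
    exact Filter.mem_of_superset (hS U hUS hU) fun n hn => ⟨U, hUS, hn⟩

/-- A finitely supported signed measure on `N_F` is modelled as a finitely supported
function `Option ℕ →₀ ℝ`; its value on a set `A` is the sum of its weights on `A`. -/
def fsMeas (μ : Option ℕ →₀ ℝ) (A : Set (Option ℕ)) : ℝ :=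
  ∑ x ∈ μ.support, A.indicator (fun y => μ y) x

/-- The norm `‖μ‖ = Σ |α_i|` of a finitely supported signed measure. -/
def fsNorm (μ : Option ℕ →₀ ℝ) : ℝ :=
  ∑ x ∈ μ.support, |μ x|

/-- `‖μ ↾ B‖`, the variation of `μ` on a set `B`. -/
def fsRestrNorm (μ : Option ℕ →₀ ℝ) (B : Set (Option ℕ)) : ℝ :=
  ∑ x ∈ μ.support, B.indicator (fun y => |μ y|) x

/-- The integral `∫ f dμ` of a function against a finitely supported signed measure. -/
def fsInteg (μ : Option ℕ →₀ ℝ) (f : Option ℕ → ℝ) : ℝ :=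
  ∑ x ∈ μ.support, μ x * f x

/-- An anti-Nikodym sequence on `N_F`: `‖μ_n‖ → ∞` and `μ_n(A) → 0` for every clopen `A`. -/
def IsANSeq (F : Filter ℕ) (μ : ℕ → (Option ℕ →₀ ℝ)) : Prop :=
  Tendsto (fun n => fsNorm (μ n)) atTop atTop ∧
    ∀ A : Set (Option ℕ), @IsClopen _ (NFTop F) A →
      Tendsto (fun n => fsMeas (μ n) A) atTop (nhds 0)

/-- A free filter `F` has the Nikodym property if there is no anti-Nikodym sequence on `N_F`. -/
def HasNikodymProp (F : Filter ℕ) : Prop :=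
  ¬ ∃ μ : ℕ → (Option ℕ →₀ ℝ), IsANSeq F μ

/-- A finitely supported (nonnegative) measure on `ℕ`, evaluated on a set `A ⊆ ℕ`. -/
def natMeas (μ : ℕ →₀ ℝ) (A : Set ℕ) : ℝ :=
  ∑ x ∈ μ.support, A.indicator (fun y => μ y) x

/-- The norm of a finitely supported measure on `ℕ`. -/
def natNorm (μ : ℕ →₀ ℝ) : ℝ :=
  ∑ x ∈ μ.support, |μ x|

/-- `at⁺(μ)`: the largest atom of a finitely supported measure on `ℕ`. -/
def atPlus (μ : ℕ →₀ ℝ) : ℝ := sSup ((fun x => μ x) '' ↑μ.support)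

/-- `at⁻(μ)`: the smallest atom of a finitely supported measure on `ℕ`. -/
def atMinus (μ : ℕ →₀ ℝ) : ℝ := sInf ((fun x => μ x) '' ↑μ.support)

/-- A submeasure on `ω`. -/
structure Submeasure where
  toFun : Set ℕ → ℝ≥0∞
  empty' : toFun ∅ = 0
  finite_singleton' : ∀ n : ℕ, toFun {n} ≠ ⊤
  mono' : ∀ ⦃A B : Set ℕ⦄, A ⊆ B → toFun A ≤ toFun B
  subadd' : ∀ A B : Set ℕ, toFun (A ∪ B) ≤ toFun A + toFun B

/-- Lower semicontinuity of a submeasure: `φ(A) = lim_n φ(A ∩ [0,n])`. -/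
def Submeasure.LSC (φ : Submeasure) : Prop :=
  ∀ A : Set ℕ, Tendsto (fun n : ℕ => φ.toFun (A ∩ Set.Iic n)) atTop (nhds (φ.toFun A))

/-- The exhaustive ideal `Exh(φ) = {A : lim_n φ(A ∖ [0,n]) = 0}` of a submeasure. -/
def Exh (φ : Submeasure) : Set (Set ℕ) :=
  {A : Set ℕ | Tendsto (fun n : ℕ => φ.toFun (A \ Set.Iic n)) atTop (nhds 0)}

/-- A density submeasure: `φ = sup_n μ_n` for a sequence of finitely supported nonnegative
measures on `ℕ` with pairwise disjoint supports. -/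
def Submeasure.IsDensity (φ : Submeasure) : Prop :=
  ∃ μ : ℕ → (ℕ →₀ ℝ), (∀ n x, 0 ≤ μ n x) ∧
    (∀ m n, m ≠ n → Disjoint (μ m).support (μ n).support) ∧
    ∀ A : Set ℕ, φ.toFun A = ⨆ n : ℕ, ENNReal.ofReal (natMeas (μ n) A)

/-- A non-pathological submeasure: `φ(A)` is the supremum of `μ(A)` over all nonnegative
(σ-additive) measures `μ` on `ℕ` dominated by `φ`. -/
def Submeasure.Nonpathological (φ : Submeasure) : Prop :=
  ∀ A : Set ℕ,
    φ.toFun A =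
      ⨆ (w : ℕ → ℝ≥0∞) (_ : ∀ B : Set ℕ, ∑' n : B, w n ≤ φ.toFun B), ∑' n : A, w n

/-- An ideal on `ω`: contains all finite sets, closed under subsets and finite unions,
and does not contain `ℕ` itself. -/
def IsIdeal (I : Set (Set ℕ)) : Prop :=
  (∀ A : Set ℕ, A.Finite → A ∈ I) ∧
    (∀ A B : Set ℕ, A ⊆ B → B ∈ I → A ∈ I) ∧
    (∀ A B : Set ℕ, A ∈ I → B ∈ I → A ∪ B ∈ I) ∧
    Set.univ ∉ I

/-- The Katětov order on families of subsets of `ℕ`. -/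
def KatLE (I J : Set (Set ℕ)) : Prop :=
  ∃ f : ℕ → ℕ, ∀ A ∈ I, f ⁻¹' A ∈ J

/-- The dual filter `I*` of an ideal `I` (as a `Filter`; when `I` is an ideal, this filter's
sets are exactly the complements of members of `I`). -/
def dualFilter (I : Set (Set ℕ)) : Filter ℕ :=
  Filter.generate {A : Set ℕ | Aᶜ ∈ I}

/-- The class `AN` of all ideals on `ω` whose dual filters do not have the Nikodym property. -/
def ANclass : Set (Set (Set ℕ)) :=
  {I | IsIdeal I ∧ ¬ HasNikodymProp (dualFilter I)}

/-- A density ideal: `Exh(sup_n μ_n)` for a disjointly supported sequence of finitely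
supported nonnegative measures on `ℕ`. -/
def IsDensityIdeal (I : Set (Set ℕ)) : Prop :=
  ∃ μ : ℕ → (ℕ →₀ ℝ), (∀ n x, 0 ≤ μ n x) ∧
    (∀ m n, m ≠ n → Disjoint (μ m).support (μ n).support) ∧
    I = {A : Set ℕ |
      Tendsto (fun m : ℕ => ⨆ n : ℕ, ENNReal.ofReal (natMeas (μ n) (A \ Set.Iic m)))
        atTop (nhds 0)}

/-- The asymptotic density submeasure `φ_d(A) = sup_n |A ∩ [2^n, 2^{n+1})|/2^n`. -/
def phid (A : Set ℕ) : ℝ≥0∞ :=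
  ⨆ n : ℕ, ((A ∩ Set.Ico (2 ^ n) (2 ^ (n + 1))).ncard : ℝ≥0∞) / 2 ^ n

/-- The asymptotic density zero ideal `Z = Exh(φ_d)`. -/
def Zideal : Set (Set ℕ) :=
  {A : Set ℕ | Tendsto (fun m : ℕ => phid (A \ Set.Iic m)) atTop (nhds 0)}

/-- `Exh(sup_{n ≥ 1} ν_n)` for a sequence of finitely supported measures indexed by `n ≥ 1`. -/
def ExhSupPos (ν : ℕ → (ℕ →₀ ℝ)) : Set (Set ℕ) :=
  {A : Set ℕ |
    Tendsto (fun m : ℕ => ⨆ n : ℕ, ENNReal.ofReal (natMeas (ν (n + 1)) (A \ Set.Iic m)))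
      atTop (nhds 0)}

/-- `PhiStart f n` is the left endpoint of the interval `I_n` in the interval partition
associated with `f` (so `I_n = [PhiStart f n, PhiStart f (n+1))` has `n·f(n)` elements). -/
def PhiStart (f : ℕ → ℕ) (n : ℕ) : ℕ :=
  ∑ k ∈ Finset.range n, k * f k

/-- The density ideal `Φ(f) = Exh(sup_{n≥1} μ_n^f)`, where `μ_n^f` gives mass `1/f(n)` to each
point of the interval `I_n` (of size `n·f(n)`), so that `‖μ_n^f‖ = n`. -/
def PhiIdeal (f : ℕ → ℕ) : Set (Set ℕ) :=
  {A : Set ℕ |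
    Tendsto (fun m : ℕ => ⨆ n : ℕ,
        ENNReal.ofReal
          (((A \ Set.Iic m) ∩ Set.Ico (PhiStart f (n + 1)) (PhiStart f (n + 2))).ncard
            / f (n + 1)))
      atTop (nhds 0)}

/-- The dominating number `𝔡`. -/
def domNumber : Cardinal :=
  sInf {c : Cardinal | ∃ D : Set (ℕ → ℕ), Cardinal.mk D = c ∧
    ∀ g : ℕ → ℕ, ∃ f ∈ D, ∀ᶠ n in atTop, g n ≤ f n}

/-- The unbounding number `𝔟`. -/
def unbNumber : Cardinal :=
  sInf {c : Cardinal | ∃ U : Set (ℕ → ℕ), Cardinal.mk U = c ∧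
    ∀ g : ℕ → ℕ, ∃ f ∈ U, {n : ℕ | g n < f n}.Infinite}

/-- A P-ideal: every countable family in `J` has a pseudo-union in `J`. -/
def IsPIdeal (J : Set (Set ℕ)) : Prop :=
  ∀ A : ℕ → Set ℕ, (∀ n, A n ∈ J) → ∃ B ∈ J, ∀ n, (A n \ B).Finite

/-- The characteristic-function embedding of `P(ℕ)` into the Cantor space `2^ℕ`. -/
def chi (A : Set ℕ) : ℕ → Bool :=
  fun n => @decide (n ∈ A) (Classical.propDecidable _)

end

section Measures

variable {μ : Option ℕ →₀ ℝ} {A B : Set (Option ℕ)}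

lemma fsMeas_eq_sum_of_subset {T : Finset (Option ℕ)} (h : μ.support ⊆ T) (A : Set (Option ℕ)) :
    fsMeas μ A = ∑ x ∈ T, A.indicator (fun y => μ y) x := by
  refine Finset.sum_subset h fun x _ hx => ?_
  rw [Finsupp.notMem_support_iff] at hx
  by_cases hA : x ∈ A <;> simp [hA, hx]

lemma fsMeas_union (h : Disjoint A B) : fsMeas μ (A ∪ B) = fsMeas μ A + fsMeas μ B := by
  simp only [fsMeas, ← Finset.sum_add_distrib]
  exact Finset.sum_congr rfl fun x _ => congrFun (Set.indicator_union_of_disjoint h _) x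

lemma fsRestrNorm_union (h : Disjoint A B) :
    fsRestrNorm μ (A ∪ B) = fsRestrNorm μ A + fsRestrNorm μ B := by
  simp only [fsRestrNorm, ← Finset.sum_add_distrib]
  exact Finset.sum_congr rfl fun x _ => congrFun (Set.indicator_union_of_disjoint h _) x

lemma fsRestrNorm_nonneg : 0 ≤ fsRestrNorm μ A :=
  Finset.sum_nonneg fun _ _ => Set.indicator_nonneg (fun _ _ => abs_nonneg _) _

lemma abs_fsMeas_le_fsRestrNorm : |fsMeas μ A| ≤ fsRestrNorm μ A := by
  refine (Finset.abs_sum_le_sum_abs _ _).trans (Finset.sum_le_sum fun x _ => ?_)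
  by_cases h : x ∈ A <;> simp [h]

lemma fsRestrNorm_univ : fsRestrNorm μ univ = fsNorm μ := by
  simp [fsRestrNorm, fsNorm]

lemma fsMeas_singleton (a : Option ℕ) : fsMeas μ {a} = μ a := by
  rw [fsMeas_eq_sum_of_subset (Finset.subset_insert a μ.support), Finset.sum_eq_single a]
  · simp
  · intro b _ hb
    simp [hb]
  · simp

lemma fsRestrNorm_singleton (a : Option ℕ) : fsRestrNorm μ {a} = |μ a| := by
  by_cases ha : a ∈ μ.support
  · rw [fsRestrNorm, Finset.sum_eq_single_of_mem a ha]
    · simp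
    · intro b _ hb
      simp [hb]
  · rw [fsRestrNorm, Finset.sum_eq_zero, Finsupp.notMem_support_iff.mp ha, abs_zero]
    intro b hb
    have : b ≠ a := fun h => ha (h ▸ hb)
    simp [this]

lemma fsMeas_add (μ ν : Option ℕ →₀ ℝ) (A : Set (Option ℕ)) :
    fsMeas (μ + ν) A = fsMeas μ A + fsMeas ν A := by
  classical
  rw [fsMeas_eq_sum_of_subset Finsupp.support_add,
    fsMeas_eq_sum_of_subset (μ := μ) Finset.subset_union_left,
    fsMeas_eq_sum_of_subset (μ := ν) Finset.subset_union_right, ← Finset.sum_add_distrib]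
  refine Finset.sum_congr rfl fun x _ => ?_
  by_cases h : x ∈ A <;> simp [h]

/-- The variation of `μ` on `B` is at most twice the supremum of `|μ|` on subsets of `B`. -/
lemma fsRestrNorm_le_of_forall_subset {ε : ℝ} (h : ∀ C ⊆ B, |fsMeas μ C| ≤ ε) :
    fsRestrNorm μ B ≤ 2 * ε := by
  have key : fsRestrNorm μ B = fsMeas μ {x ∈ B | 0 ≤ μ x} - fsMeas μ {x ∈ B | μ x < 0} := by
    simp only [fsRestrNorm, fsMeas, ← Finset.sum_sub_distrib]
    refine Finset.sum_congr rfl fun x _ => ?_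
    by_cases hB : x ∈ B
    · rcases le_or_gt 0 (μ x) with hx | hx
      · simp [Set.indicator, hB, hx, abs_of_nonneg hx, not_lt.mpr hx]
      · simp [Set.indicator, hB, hx, abs_of_neg hx, not_le.mpr hx]
    · simp [Set.indicator, hB]
  have h1 := (abs_le.mp (h {x ∈ B | 0 ≤ μ x} fun x hx => hx.1)).2
  have h2 := (abs_le.mp (h {x ∈ B | μ x < 0} fun x hx => hx.1)).1
  linarith

lemma fsRestrNorm_le_sum_abs (T : Finset (Option ℕ)) :
    fsRestrNorm μ (A ∩ T) ≤ ∑ t ∈ T, A.indicator (fun y => |μ y|) t := by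
  classical
  have : fsRestrNorm μ (A ∩ T) = ∑ x ∈ μ.support ∩ T, A.indicator (fun y => |μ y|) x := by
    rw [fsRestrNorm, ← Finset.filter_mem_eq_inter, Finset.sum_filter]
    refine Finset.sum_congr rfl fun x _ => ?_
    by_cases h1 : x ∈ A <;> by_cases h2 : x ∈ T <;> simp [h1, h2, Set.indicator]
  rw [this]
  exact Finset.sum_le_sum_of_subset_of_nonneg Finset.inter_subset_right
    fun _ _ _ => Set.indicator_nonneg (fun _ _ => abs_nonneg _) _

lemma continuous_fsMeas_setOf (μ : Option ℕ →₀ ℝ) (A : Set (Option ℕ)) :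
    Continuous fun x : Option ℕ → Bool => fsMeas μ {a ∈ A | x a = true} := by
  classical
  refine continuous_finsetSum _ fun a _ => ?_
  have : (fun x : Option ℕ → Bool => indicator {a ∈ A | x a = true} (fun y => μ y) a) =
      (fun b : Bool => if a ∈ A ∧ b = true then μ a else 0) ∘ fun x => x a := by
    ext x
    simp [Set.indicator]
  rw [this]
  exact continuous_of_discreteTopology.comp (continuous_apply a)

/-- Schur's theorem for finitely supported measures: setwise convergence to `0` on all subsets
of `A` implies convergence of the variations on `A`. -/
theorem tendsto_fsRestrNorm_of_forall_subset {μ : ℕ → (Option ℕ →₀ ℝ)}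
    (h : ∀ B ⊆ A, Tendsto (fun n => fsMeas (μ n) B) atTop (𝓝 0)) :
    Tendsto (fun n => fsRestrNorm (μ n) A) atTop (𝓝 0) := by
  classical
  have small : ∀ ε > 0, ∀ᶠ n in atTop, fsRestrNorm (μ n) A ≤ 5 * ε := by
    intro ε hε
    let K : ℕ → Set (Option ℕ → Bool) :=
      fun m => {x | ∀ n ≥ m, |fsMeas (μ n) {a ∈ A | x a = true}| ≤ ε}
    have hK : ∀ m, IsClosed (K m) := fun m => by
      simp only [K, Set.ofPred_forall]
      exact isClosed_iInter fun n => isClosed_iInter fun _ =>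
        isClosed_le (continuous_fsMeas_setOf (μ n) A).abs continuous_const
    have hU : ⋃ m, K m = univ := by
      refine Set.eq_univ_of_forall fun x => Set.mem_iUnion.mpr ?_
      obtain ⟨m, hm⟩ := Metric.tendsto_atTop.mp
        (h {a ∈ A | x a = true} fun a ha => ha.1) ε hε
      exact ⟨m, fun n hn => by simpa using (hm n hn).le⟩
    obtain ⟨m, x₀, hx₀⟩ := nonempty_interior_of_iUnion_of_closed hK hU
    obtain ⟨T, u, hu, hTu⟩ := isOpen_pi_iff.mp isOpen_interior x₀ hx₀
    have hmem : ∀ x : Option ℕ → Bool, (∀ a ∈ T, x a = x₀ a) → x ∈ K m := fun x hx =>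
      interior_subset (hTu fun a ha => by rw [hx a ha]; exact (hu a ha).2)
    have hout : ∀ n ≥ m, fsRestrNorm (μ n) (A \ T) ≤ 4 * ε := by
      intro n hn
      have : ∀ C ⊆ A \ (T : Set (Option ℕ)), |fsMeas (μ n) C| ≤ 2 * ε := by
        intro C hC
        have h1 := hmem (fun a => if a ∈ T then x₀ a else decide (a ∈ C))
          (fun a ha => by simp [ha]) n hn
        have h2 := hmem (fun a => if a ∈ T then x₀ a else false) (fun a ha => by simp [ha]) n hn
        have hsplit : {a ∈ A | (if a ∈ T then x₀ a else decide (a ∈ C)) = true} =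
            {a ∈ A | (if a ∈ T then x₀ a else false) = true} ∪ C := by
          ext a
          have hCa := @hC a
          by_cases ha : a ∈ T <;> by_cases haC : a ∈ C <;> simp_all
        have hdisj : Disjoint {a ∈ A | (if a ∈ T then x₀ a else false) = true} C := by
          refine Set.disjoint_left.mpr fun a ha haC => ?_
          have hCa := hC haC
          simp_all
        rw [hsplit, fsMeas_union hdisj] at h1
        rw [abs_le] at *
        constructor <;> linarith [h1.1, h1.2, h2.1, h2.2]
      linarith [fsRestrNorm_le_of_forall_subset this]
    have hin : Tendsto (fun n => ∑ t ∈ T, A.indicator (fun y => |μ n y|) t) atTop (𝓝 0) := by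
      rw [← Finset.sum_const_zero (s := T)]
      refine tendsto_finsetSum _ fun t _ => ?_
      by_cases ht : t ∈ A
      · have := (h {t} (by simpa using ht)).abs
        simpa [ht, fsMeas_singleton] using this
      · simp [ht]
    filter_upwards [eventually_ge_atTop m, hin.eventually (ge_mem_nhds hε)] with n hn hn'
    have hA : A = A \ T ∪ A ∩ T := (Set.sdiff_union_inter A _).symm
    rw [hA, fsRestrNorm_union (Set.disjoint_sdiff_inter)]
    linarith [hout n hn, fsRestrNorm_le_sum_abs (μ := μ n) (A := A) T]
  refine tendsto_order.mpr ⟨fun a ha => .of_forall fun n => ha.trans_le fsRestrNorm_nonneg, ?_⟩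
  intro a ha
  filter_upwards [small (a / 10) (by positivity)] with n hn
  linarith

lemma fsNorm_le (μ : Option ℕ →₀ ℝ) :
    fsNorm μ ≤ 2 * fsRestrNorm μ (range some) + |fsMeas μ univ| := by
  have hd : Disjoint (range (some : ℕ → Option ℕ)) {none} := by simp
  have hu : (univ : Set (Option ℕ)) = range some ∪ {none} := by
    ext x
    cases x <;> simp
  have h1 := fsRestrNorm_union (μ := μ) hd
  have h2 := fsMeas_union (μ := μ) hd
  rw [← hu] at h1 h2
  rw [fsRestrNorm_univ, fsRestrNorm_singleton] at h1
  rw [fsMeas_singleton] at h2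
  have h3 := abs_fsMeas_le_fsRestrNorm (μ := μ) (A := range some)
  have h4 : |μ none| ≤ |fsMeas μ univ| + |fsMeas μ (range some)| := by
    rw [eq_sub_of_add_eq' h2.symm]
    exact abs_sub _ _
  linarith

lemma fsRestrNorm_image_some (μ : Option ℕ →₀ ℝ) (A : Set ℕ) :
    fsRestrNorm μ (some '' A) =
      ∑ x ∈ Finset.eraseNone μ.support, A.indicator (fun y => |μ (some y)|) x := by
  classical
  have : fsRestrNorm μ (some '' A) = ∑ x ∈ (Finset.eraseNone μ.support).map .some,
      (some '' A).indicator (fun y => |μ y|) x := by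
    rw [Finset.map_some_eraseNone]
    refine (Finset.sum_subset (Finset.erase_subset _ _) fun x _ hx => ?_).symm
    have : x = none := by
      by_contra hne
      simp_all
    simp [this]
  rw [this, Finset.sum_map]
  refine Finset.sum_congr rfl fun x _ => ?_
  by_cases h : x ∈ A <;> simp [h]

end Measures

section Filters

variable {I : Set (Set ℕ)}

lemma mem_dualFilter (hI : IsIdeal I) {A : Set ℕ} : A ∈ dualFilter I ↔ Aᶜ ∈ I := by
  obtain ⟨hfin, hsub, hunion, -⟩ := hI
  refine ⟨fun h => ?_, fun h => Filter.mem_generate_of_mem h⟩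
  induction h with
  | basic h => exact h
  | univ => simpa using hfin ∅ Set.finite_empty
  | superset _ hst ih => exact hsub _ _ (Set.compl_subset_compl.mpr hst) ih
  | inter _ _ ihs iht =>
    rw [Set.compl_inter]
    exact hunion _ _ ihs iht

lemma isClopen_image_some (hI : IsIdeal I) {A : Set ℕ} (hA : A ∈ I) :
    @IsClopen _ (NFTop (dualFilter I)) (some '' A) := by
  let _ := NFTop (dualFilter I)
  refine ⟨⟨fun _ => ?_⟩, fun h => by simp at h⟩
  rw [mem_dualFilter hI]
  convert hA using 1
  ext x
  simp

/-- The failure of the Nikodym property of `I*` yields measures of norm at least `n` whose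
variations converge to `0` on every member of `I`. -/
lemma exists_fsRestrNorm_tendsto_of_mem_ANclass (hI : I ∈ ANclass) :
    ∃ μ : ℕ → (Option ℕ →₀ ℝ), (∀ n : ℕ, (n : ℝ) ≤ fsRestrNorm (μ n) (range some)) ∧
      ∀ A ∈ I, Tendsto (fun n => fsRestrNorm (μ n) (some '' A)) atTop (𝓝 0) := by
  obtain ⟨hI, hN⟩ := hI
  obtain ⟨μ, hnorm, hclopen⟩ := not_not.mp hN
  have hzero : ∀ A ∈ I, Tendsto (fun n => fsRestrNorm (μ n) (some '' A)) atTop (𝓝 0) := by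
    intro A hA
    refine tendsto_fsRestrNorm_of_forall_subset fun B hB => ?_
    obtain ⟨C, hC, rfl⟩ := Set.subset_image_iff.mp hB
    exact hclopen _ (isClopen_image_some hI (hI.2.1 _ _ hC hA))
  have huniv := (hclopen univ (@isClopen_univ _ (NFTop (dualFilter I)))).abs
  have hex : ∀ n : ℕ, ∃ k ≥ n, (n : ℝ) ≤ fsRestrNorm (μ k) (range some) := by
    intro n
    obtain ⟨k, hk, hk1, hk2⟩ := ((eventually_ge_atTop n).and
      ((hnorm.eventually_ge_atTop (2 * n + 1)).and
        (huniv.eventually (ge_mem_nhds (by simp : |(0 : ℝ)| < 1))))).exists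
    exact ⟨k, hk, by linarith [fsNorm_le (μ k)]⟩
  choose k hk hkn using hex
  exact ⟨fun n => μ (k n), hkn,
    fun A hA => (hzero A hA).comp (tendsto_atTop_mono hk tendsto_id)⟩

end Filters

section Discretization

open Classical in
/-- A nonnegative measure of mass at least `N` can be approximated, up to an error `1 / F` at each
point of its support, by the image of a measure with `N * F` atoms of mass `1 / F`. -/
lemma exists_map_card_le (S : Finset ℕ) (w : ℕ → ℝ) (hw : ∀ x, 0 ≤ w x) (N F : ℕ)
    (hN : (N : ℝ) ≤ ∑ x ∈ S, w x) :
    ∃ h : ℕ → ℕ, ∀ A : Set ℕ, (((Finset.range (N * F)).filter fun i => h i ∈ A).card : ℝ) ≤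
      F * ∑ x ∈ S, A.indicator w x + S.card := by
  let P : Finset (Σ _ : ℕ, ℕ) := S.sigma fun x => Finset.range ⌈w x * F⌉₊
  have hcard : (Finset.range (N * F)).card ≤ P.card := by
    rw [Finset.card_sigma, Finset.card_range]
    simp only [Finset.card_range]
    rw [← Nat.cast_le (α := ℝ)]
    push_cast
    calc (N : ℝ) * F ≤ (∑ x ∈ S, w x) * F := by gcongr
      _ = ∑ x ∈ S, w x * F := Finset.sum_mul _ _ _
      _ ≤ ∑ x ∈ S, (⌈w x * F⌉₊ : ℝ) := Finset.sum_le_sum fun x _ => Nat.le_ceil _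
  obtain ⟨g, hgP, hginj⟩ : ∃ g : ℕ → Σ _ : ℕ, ℕ, (∀ i ∈ Finset.range (N * F), g i ∈ P) ∧
      Set.InjOn g (Finset.range (N * F)) := by
    obtain ⟨Q, hQP, hQ⟩ := Finset.exists_subset_card_eq hcard
    obtain ⟨e⟩ : Nonempty (Finset.range (N * F) ≃ Q) := ⟨Finset.equivOfCardEq hQ.symm⟩
    refine ⟨fun i => if hi : i ∈ Finset.range (N * F) then (e ⟨i, hi⟩).1 else ⟨0, 0⟩, ?_, ?_⟩
    · intro i hi
      simp only [dif_pos hi]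
      exact hQP (e ⟨i, hi⟩).2
    · intro i hi j hj hij
      rw [Finset.mem_coe] at hi hj
      simp only [dif_pos hi, dif_pos hj] at hij
      simpa using e.injective (Subtype.ext hij)
  refine ⟨fun i => (g i).1, fun A => ?_⟩
  have hle : ((Finset.range (N * F)).filter fun i => (g i).1 ∈ A).card ≤
      ∑ x ∈ S.filter (· ∈ A), ⌈w x * F⌉₊ := by
    have : ∑ x ∈ S.filter (· ∈ A), ⌈w x * F⌉₊ =
        ((S.filter (· ∈ A)).sigma fun x => Finset.range ⌈w x * F⌉₊).card := by
      simp [Finset.card_sigma]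
    rw [this]
    refine Finset.card_le_card_of_injOn g (fun i hi => ?_) (hginj.mono ?_)
    · simp only [Finset.coe_filter, Set.mem_ofPred_eq] at hi
      have := hgP i hi.1
      simp only [P, Finset.mem_sigma] at this
      simp only [Finset.coe_sigma, Finset.mem_coe, Set.mem_sigma_iff, Finset.mem_filter]
      exact ⟨⟨this.1, hi.2⟩, this.2⟩
    · exact_mod_cast Finset.filter_subset _ _
  calc (((Finset.range (N * F)).filter fun i => (g i).1 ∈ A).card : ℝ)
      ≤ ∑ x ∈ S.filter (· ∈ A), (⌈w x * F⌉₊ : ℝ) := by exact_mod_cast hle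
    _ ≤ ∑ x ∈ S.filter (· ∈ A), (w x * F + 1) := Finset.sum_le_sum fun x _ =>
        (Nat.ceil_lt_add_one (mul_nonneg (hw x) F.cast_nonneg)).le
    _ = F * ∑ x ∈ S, A.indicator w x + (S.filter (· ∈ A)).card := by
        rw [Finset.sum_add_distrib, ← Finset.sum_mul, mul_comm, Finset.sum_filter]
        simp [Set.indicator]
    _ ≤ F * ∑ x ∈ S, A.indicator w x + S.card := by
        gcongr
        exact Finset.filter_subset _ _

end Discretization

section Blocks

/-- A code for the restriction of `f` to `{0, …, n - 1}`. -/
noncomputable def initCode (f : ℕ → ℕ) (n : ℕ) : ℕ :=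
  Encodable.encode ((List.range n).map f)

lemma initCode_eq_iff {f g : ℕ → ℕ} {m n : ℕ} :
    initCode f m = initCode g n ↔ m = n ∧ ∀ i < m, f i = g i := by
  rw [initCode, initCode, Encodable.encode_inj]
  constructor
  · intro h
    have hmn : m = n := by simpa using congrArg List.length h
    subst hmn
    exact ⟨rfl, by simpa using h⟩
  · rintro ⟨rfl, h⟩
    simpa using h

lemma initCode_injective (f : ℕ → ℕ) : Function.Injective (initCode f) :=
  fun _ _ h => (initCode_eq_iff.mp h).1

/-- The points of the `n`-th block of `f`: there are `n * (f n + 1)` of them. -/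
noncomputable def block (f : ℕ → ℕ) (n : ℕ) : Finset ℕ :=
  (Finset.range (n * (f n + 1))).image (Nat.pair (initCode f n))

lemma unpair_fst_of_mem_block {f : ℕ → ℕ} {n x : ℕ} (h : x ∈ block f n) :
    x.unpair.1 = initCode f n := by
  obtain ⟨i, -, rfl⟩ := Finset.mem_image.mp h
  simp

/-- The measure giving mass `1 / (f n + 1)` to each point of the `n`-th block of `f`. -/
noncomputable def blockMeas (f : ℕ → ℕ) (n : ℕ) : ℕ →₀ ℝ :=
  Finsupp.indicator (block f n) fun _ _ => 1 / (f n + 1 : ℝ)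

lemma blockMeas_apply (f : ℕ → ℕ) (n x : ℕ) :
    blockMeas f n x = if x ∈ block f n then 1 / (f n + 1 : ℝ) else 0 := by
  simp [blockMeas, Finsupp.indicator_apply]

lemma blockMeas_nonneg (f : ℕ → ℕ) (n x : ℕ) : 0 ≤ blockMeas f n x := by
  rw [blockMeas_apply]
  split_ifs <;> positivity

lemma support_blockMeas (f : ℕ → ℕ) (n : ℕ) : (blockMeas f n).support = block f n := by
  ext x
  rw [Finsupp.mem_support_iff, blockMeas_apply]
  have : (f n + 1 : ℝ) ≠ 0 := by positivity
  simp [this]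

open Classical in
lemma natMeas_blockMeas (f : ℕ → ℕ) (n : ℕ) (A : Set ℕ) :
    natMeas (blockMeas f n) A =
      ((Finset.range (n * (f n + 1))).filter fun i => Nat.pair (initCode f n) i ∈ A).card /
        (f n + 1 : ℝ) := by
  have hinj : Set.InjOn (Nat.pair (initCode f n)) (Finset.range (n * (f n + 1))) :=
    fun i _ j _ h => (Nat.pair_eq_pair.mp h).2
  rw [natMeas, support_blockMeas]
  have : ∀ x ∈ block f n, A.indicator (fun y => blockMeas f n y) x =
      if x ∈ A then 1 / (f n + 1 : ℝ) else 0 := fun x hx => by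
    simp [Set.indicator, blockMeas_apply, hx]
  rw [Finset.sum_congr rfl this, block, Finset.sum_image hinj, ← Finset.sum_filter]
  simp [div_eq_mul_inv]

section NatMeas

variable {μ : ℕ →₀ ℝ} {A B : Set ℕ}

lemma natMeas_nonneg (h : ∀ x, 0 ≤ μ x) : 0 ≤ natMeas μ A :=
  Finset.sum_nonneg fun x _ => Set.indicator_nonneg (fun y _ => h y) x

lemma natMeas_mono (h : ∀ x, 0 ≤ μ x) (hAB : A ⊆ B) : natMeas μ A ≤ natMeas μ B :=
  Finset.sum_le_sum fun x _ => Set.indicator_le_indicator_of_subset hAB h x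

lemma natMeas_union_le (h : ∀ x, 0 ≤ μ x) : natMeas μ (A ∪ B) ≤ natMeas μ A + natMeas μ B := by
  simp only [natMeas, ← Finset.sum_add_distrib]
  refine Finset.sum_le_sum fun x _ => ?_
  have := h x
  by_cases h1 : x ∈ A <;> by_cases h2 : x ∈ B <;> simp [h1, h2, this]

lemma natMeas_congr (h : ∀ x ∈ μ.support, x ∈ A ↔ x ∈ B) : natMeas μ A = natMeas μ B := by
  classical
  refine Finset.sum_congr rfl fun x hx => ?_
  simp [Set.indicator, h x hx]

lemma natMeas_eq_zero (h : ∀ x ∈ μ.support, x ∉ A) : natMeas μ A = 0 :=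
  Finset.sum_eq_zero fun x hx => Set.indicator_of_notMem (h x hx) _

end NatMeas

/-- For measures whose supports escape to infinity, `Exh (sup_n μ_n)` consists of the sets whose
measures tend to `0`. -/
lemma tendsto_iSup_natMeas_iff {μ : ℕ → (ℕ →₀ ℝ)} (hμ : ∀ n x, 0 ≤ μ n x)
    (hsupp : ∀ m, ∀ᶠ n in atTop, ∀ x ∈ (μ n).support, m < x) (A : Set ℕ) :
    Tendsto (fun m : ℕ => ⨆ n : ℕ, ENNReal.ofReal (natMeas (μ n) (A \ Set.Iic m))) atTop (𝓝 0) ↔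
      Tendsto (fun n => natMeas (μ n) A) atTop (𝓝 0) := by
  constructor
  · intro h
    refine tendsto_order.mpr
      ⟨fun a ha => .of_forall fun n => ha.trans_le (natMeas_nonneg (hμ n)), fun a ha => ?_⟩
    obtain ⟨m, hm⟩ := (h.eventually (gt_mem_nhds (ENNReal.ofReal_pos.mpr ha))).exists
    filter_upwards [hsupp m] with n hn
    have h1 := (le_iSup (fun n => ENNReal.ofReal (natMeas (μ n) (A \ Set.Iic m))) n).trans_lt hm
    rw [ENNReal.ofReal_lt_ofReal_iff ha] at h1
    rwa [natMeas_congr (B := A)] at h1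
    intro x hx
    simp [hn x hx]
  · intro h
    refine ENNReal.tendsto_nhds_zero.mpr fun ε hε => ?_
    obtain ⟨N, hN⟩ := eventually_atTop.mp
      ((ENNReal.tendsto_ofReal h).eventually (ge_mem_nhds (by simpa using hε)))
    obtain ⟨M, hM⟩ := ((Finset.range N).biUnion fun n => (μ n).support).bddAbove
    filter_upwards [eventually_ge_atTop M] with m hm
    refine iSup_le fun n => ?_
    rcases le_or_gt N n with hn | hn
    · exact (ENNReal.ofReal_le_ofReal (natMeas_mono (hμ n) Set.sdiff_subset)).trans (hN n hn)
    · rw [natMeas_eq_zero]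
      · simp
      · intro x hx hxA
        have : x ≤ M := hM (by simpa using ⟨n, hn, Finsupp.mem_support_iff.mp hx⟩)
        exact hxA.2 (this.trans hm)

lemma eventually_lt_of_mem_block (f : ℕ → ℕ) (m : ℕ) :
    ∀ᶠ n in atTop, ∀ x ∈ (blockMeas f n).support, m < x := by
  have h := (initCode_injective f).nat_tendsto_atTop
  filter_upwards [h.eventually_gt_atTop m] with n hn x hx
  rw [support_blockMeas] at hx
  have := Nat.unpair_left_le x
  rw [unpair_fst_of_mem_block hx] at this
  omega

/-- The density ideal of sets whose relative measures in the blocks of `f` tend to `0`. -/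
noncomputable def blockIdeal (f : ℕ → ℕ) : Set (Set ℕ) :=
  {A | Tendsto (fun n => natMeas (blockMeas f n) A) atTop (𝓝 0)}

lemma natMeas_blockMeas_eq (f : ℕ → ℕ) (n : ℕ) {A : Set ℕ} (h : ↑(block f n) ⊆ A) :
    natMeas (blockMeas f n) A = n := by
  classical
  rw [natMeas_blockMeas, Finset.filter_true_of_mem, Finset.card_range]
  · have : (f n + 1 : ℝ) ≠ 0 := by positivity
    push_cast
    field_simp
  · intro i hi
    exact h (Finset.mem_coe.mpr (Finset.mem_image_of_mem _ hi))

lemma notMem_blockIdeal {f : ℕ → ℕ} {A : Set ℕ} (h : ∀ n, ↑(block f n) ⊆ A) :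
    A ∉ blockIdeal f := by
  intro hA
  have : Tendsto (fun n : ℕ => (n : ℝ)) atTop (𝓝 0) := by
    simpa only [blockIdeal, Set.mem_ofPred_eq, natMeas_blockMeas_eq f _ (h _)] using hA
  exact not_tendsto_nhds_of_tendsto_atTop tendsto_natCast_atTop_atTop 0 this

lemma isDensityIdeal_blockIdeal (f : ℕ → ℕ) : IsDensityIdeal (blockIdeal f) := by
  refine ⟨blockMeas f, blockMeas_nonneg f, fun m n hmn => ?_, ?_⟩
  · simp only [support_blockMeas]
    refine Finset.disjoint_left.mpr fun x hm hn => hmn (initCode_injective f ?_)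
    rw [← unpair_fst_of_mem_block hm, unpair_fst_of_mem_block hn]
  · ext A
    exact (tendsto_iSup_natMeas_iff (blockMeas_nonneg f) (eventually_lt_of_mem_block f) A).symm

lemma isIdeal_blockIdeal (f : ℕ → ℕ) : IsIdeal (blockIdeal f) := by
  refine ⟨fun A hA => ?_, fun A B hAB hB => ?_, fun A B hA hB => ?_,
    notMem_blockIdeal fun _ => Set.subset_univ _⟩
  · obtain ⟨m, hm⟩ := hA.bddAbove
    refine tendsto_const_nhds.congr' ?_
    filter_upwards [eventually_lt_of_mem_block f m] with n hn
    exact (natMeas_eq_zero fun x hx hxA => (hn x hx).not_ge (hm hxA)).symm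
  · exact squeeze_zero (fun n => natMeas_nonneg (blockMeas_nonneg f n))
      (fun n => natMeas_mono (blockMeas_nonneg f n) hAB) hB
  · exact squeeze_zero (fun n => natMeas_nonneg (blockMeas_nonneg f n))
      (fun n => natMeas_union_le (blockMeas_nonneg f n)) (by simpa using hA.add hB)

lemma fsMeas_embDomain_some (μ : ℕ →₀ ℝ) (A : Set (Option ℕ)) :
    fsMeas (μ.embDomain .some) A = natMeas μ (some ⁻¹' A) := by
  classical
  rw [fsMeas, Finsupp.support_embDomain, Finset.sum_map]
  refine Finset.sum_congr rfl fun x _ => ?_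
  by_cases h : some x ∈ A
  · simp [Set.indicator, h]
  · simp [h]

lemma fsMeas_single (c : ℝ) (A : Set (Option ℕ)) [Decidable (none ∈ A)] :
    fsMeas (Finsupp.single none c) A = if none ∈ A then c else 0 := by
  rw [fsMeas_eq_sum_of_subset (Finsupp.support_single_subset)]
  simp [Set.indicator]

lemma blockIdeal_mem_ANclass (f : ℕ → ℕ) : blockIdeal f ∈ ANclass := by
  classical
  have hI := isIdeal_blockIdeal f
  refine ⟨hI, not_not.mpr ?_⟩
  let ν : ℕ → (Option ℕ →₀ ℝ) := fun n =>
    (blockMeas f n).embDomain .some + Finsupp.single none (-n : ℝ)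
  have hν : ∀ n A, fsMeas (ν n) A =
      natMeas (blockMeas f n) (some ⁻¹' A) + if none ∈ A then (-n : ℝ) else 0 := fun n A => by
    rw [fsMeas_add, fsMeas_embDomain_some, fsMeas_single]
  refine ⟨ν, ?_, fun A hA => ?_⟩
  · refine tendsto_atTop_mono (fun n => ?_) tendsto_natCast_atTop_atTop
    have h1 : fsMeas (ν n) (range some) = n := by
      rw [hν, natMeas_blockMeas_eq f n (by simp)]
      simp
    have hu : fsMeas (ν n) (range some) + fsMeas (ν n) {none} = fsMeas (ν n) univ := by
      rw [← fsMeas_union (by simp)]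
      congr 1
      ext x
      cases x <;> simp
    have h2 := abs_fsMeas_le_fsRestrNorm (μ := ν n) (A := range some)
    have h3 : fsRestrNorm (ν n) univ =
        fsRestrNorm (ν n) (range some) + fsRestrNorm (ν n) {none} := by
      rw [← fsRestrNorm_union (by simp)]
      congr 1
      ext x
      cases x <;> simp
    rw [fsRestrNorm_univ] at h3
    have h4 := fsRestrNorm_nonneg (μ := ν n) (A := {none})
    have h5 := le_abs_self (fsMeas (ν n) (range some))
    linarith
  · have out : ∀ B : Set (Option ℕ), @IsClopen _ (NFTop (dualFilter (blockIdeal f))) B →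
        none ∉ B → Tendsto (fun n => fsMeas (ν n) B) atTop (𝓝 0) := by
      intro B hB hnB
      have hopen := @IsClosed.isOpen_compl _ (NFTop (dualFilter (blockIdeal f))) _ hB.1
      have hmem := (mem_dualFilter hI).mp (hopen hnB)
      simp only [hν, if_neg hnB, add_zero]
      have : some ⁻¹' B = {n : ℕ | some n ∈ Bᶜ}ᶜ := by
        ext x
        simp
      rw [this]
      exact hmem
    by_cases hn : none ∈ A
    · have hc := out Aᶜ (@IsClopen.compl _ (NFTop (dualFilter (blockIdeal f))) _ hA)
        (by simpa using hn)
      have huniv : ∀ n, fsMeas (ν n) univ = 0 := fun n => by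
        rw [hν, natMeas_blockMeas_eq f n (by simp)]
        simp
      have : ∀ n, fsMeas (ν n) A = -fsMeas (ν n) Aᶜ := fun n => by
        have := fsMeas_union (μ := ν n) (disjoint_compl_right (a := A))
        rw [Set.union_compl_self, huniv] at this
        linarith
      simpa [this] using hc.neg
    · exact out A hA hn

lemma blockIdeal_injective : Function.Injective blockIdeal := by
  intro f g hfg
  by_contra hne
  obtain ⟨k, hk⟩ := Function.ne_iff.mp hne
  have hf : (⋃ n, ↑(block f n) : Set ℕ) ∉ blockIdeal f :=
    notMem_blockIdeal fun n => Set.subset_iUnion (fun n => (block f n : Set ℕ)) n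
  refine hf (hfg ▸ tendsto_const_nhds.congr' ?_)
  filter_upwards [eventually_gt_atTop k] with n hn
  refine (natMeas_eq_zero fun x hx hxf => ?_).symm
  obtain ⟨m, hm⟩ := Set.mem_iUnion.mp hxf
  rw [support_blockMeas] at hx
  have := (unpair_fst_of_mem_block hx).symm.trans (unpair_fst_of_mem_block hm)
  exact hk ((initCode_eq_iff.mp this).2 k hn).symm

/-- Every ideal in `AN` is Katětov below `blockIdeal f` once `f` grows fast enough. -/
lemma exists_katLE_blockIdeal {I : Set (Set ℕ)} (hI : I ∈ ANclass) :
    ∃ g : ℕ → ℕ, ∀ f : ℕ → ℕ, (∀ᶠ n in atTop, g n ≤ f n) → KatLE I (blockIdeal f) := by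
  classical
  obtain ⟨μ, hμ, hzero⟩ := exists_fsRestrNorm_tendsto_of_mem_ANclass hI
  let S : ℕ → Finset ℕ := fun n => Finset.eraseNone (μ n).support
  refine ⟨fun n => n * (S n).card, fun f hf => ?_⟩
  have hN : ∀ n : ℕ, (n : ℝ) ≤ ∑ x ∈ S n, |μ n (some x)| := fun n => by
    have := hμ n
    rw [← Set.image_univ, fsRestrNorm_image_some] at this
    simpa using this
  choose h hh using fun n =>
    exists_map_card_le (S n) (fun x => |μ n (some x)|) (fun x => abs_nonneg _) n (f n + 1) (hN n)
  let F : ℕ → ℕ := fun x =>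
    if hx : ∃ n, initCode f n = x.unpair.1 then h hx.choose x.unpair.2 else 0
  have hF : ∀ n i, F (Nat.pair (initCode f n) i) = h n i := fun n i => by
    have hx : ∃ k, initCode f k = (Nat.pair (initCode f n) i).unpair.1 := ⟨n, by simp⟩
    have hn : hx.choose = n := initCode_injective f (by simpa using hx.choose_spec)
    refine (dif_pos hx).trans ?_
    rw [hn, Nat.unpair_pair]
  refine ⟨F, fun A hA => ?_⟩
  have hbound : Tendsto (fun n : ℕ => fsRestrNorm (μ n) (some '' A) + 1 / (n : ℝ)) atTop (𝓝 0) := by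
    simpa using (hzero A hA).add tendsto_one_div_atTop_nhds_zero_nat
  refine squeeze_zero' (.of_forall fun n => natMeas_nonneg (blockMeas_nonneg f n)) ?_ hbound
  filter_upwards [hf, eventually_gt_atTop 0] with n hn hpos
  have hcount := hh n A
  rw [← fsRestrNorm_image_some] at hcount
  have hpos' : (0 : ℝ) < n := by exact_mod_cast hpos
  have hF1 : (0 : ℝ) < f n + 1 := by positivity
  rw [natMeas_blockMeas, div_le_iff₀ hF1]
  simp only [Set.mem_preimage, hF]
  have hcard : ((S n).card : ℝ) ≤ 1 / n * (f n + 1) := by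
    rw [one_div, inv_mul_eq_div, le_div_iff₀ hpos']
    have : (n : ℝ) * (S n).card ≤ f n := by exact_mod_cast hn
    linarith
  push_cast at hcount
  linarith

end Blocks

lemma exists_dominating_of_card_eq_domNumber :
    ∃ D : Set (ℕ → ℕ), Cardinal.mk D = domNumber ∧
      ∀ g : ℕ → ℕ, ∃ f ∈ D, ∀ᶠ n in atTop, g n ≤ f n :=
  csInf_mem (s := {c : Cardinal | ∃ D : Set (ℕ → ℕ), Cardinal.mk D = c ∧
    ∀ g : ℕ → ℕ, ∃ f ∈ D, ∀ᶠ n in atTop, g n ≤ f n})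
    ⟨_, univ, rfl, fun g => ⟨g, mem_univ g, .of_forall fun _ => le_rfl⟩⟩

/-- Theorem `dom`. There is a family `𝔽` of density ideals, all in the class
`AN`, of cardinality the dominating number `𝔡`, which is `≤_K`-dominating in `AN`. -/
theorem AN_has_dominating_family_of_size_d :
    ∃ 𝔽 : Set (Set (Set ℕ)), Cardinal.mk 𝔽 = domNumber ∧
      (∀ J ∈ 𝔽, IsDensityIdeal J ∧ J ∈ ANclass) ∧
      ∀ I ∈ ANclass, ∃ J ∈ 𝔽, KatLE I J := by
  obtain ⟨D, hcard, hD⟩ := exists_dominating_of_card_eq_domNumber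
  refine ⟨blockIdeal '' D, ?_, ?_, fun I hI => ?_⟩
  · rw [Cardinal.mk_image_eq blockIdeal_injective, hcard]
  · rintro _ ⟨f, -, rfl⟩
    exact ⟨isDensityIdeal_blockIdeal f, blockIdeal_mem_ANclass f⟩
  · obtain ⟨g, hg⟩ := exists_katLE_blockIdeal hI
    obtain ⟨f, hf, hgf⟩ := hD g
    exact ⟨_, Set.mem_image_of_mem _ hf, hg f hgf⟩
end

section
/- For every ideal I ∈ AN there exists an ideal J ∈ AN such that I <_K J (i.e., I ≤_K J and J ≰_K I). Consequently, the class AN has no ≤_K-maximal element. -/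
open Filter Topology Set MeasureTheory
open scoped ENNReal NNReal

/-- The value on `A` of the measure with weights `w` restricted to the finite set `S`. -/
noncomputable def mass (S : Finset ℕ) (w : ℕ → ℝ) (A : Set ℕ) : ℝ :=
  ∑ x ∈ S, A.indicator w x

/-- The family of sets on which the measures given by `S` and `w` converge to `0`. -/
def nullSets (S : ℕ → Finset ℕ) (w : ℕ → ℕ → ℝ) : Set (Set ℕ) :=
  {A | Tendsto (fun n => mass (S n) (w n) A) atTop (𝓝 0)}

lemma mass_nonneg {S : Finset ℕ} {w : ℕ → ℝ} (hw : ∀ x, 0 ≤ w x) (A : Set ℕ) :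
    0 ≤ mass S w A :=
  Finset.sum_nonneg fun x _ => Set.indicator_nonneg (fun y _ => hw y) x

lemma mass_mono {S : Finset ℕ} {w : ℕ → ℝ} (hw : ∀ x, 0 ≤ w x) {A B : Set ℕ} (h : A ⊆ B) :
    mass S w A ≤ mass S w B :=
  Finset.sum_le_sum fun x _ => Set.indicator_le_indicator_of_subset h hw x

lemma mass_union_le {S : Finset ℕ} {w : ℕ → ℝ} (hw : ∀ x, 0 ≤ w x) (A B : Set ℕ) :
    mass S w (A ∪ B) ≤ mass S w A + mass S w B := by
  unfold mass
  rw [← Finset.sum_add_distrib]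
  refine Finset.sum_le_sum fun x _ => ?_
  have := hw x
  by_cases hA : x ∈ A <;> by_cases hB : x ∈ B <;> simp [hA, hB, this]

lemma mass_univ (S : Finset ℕ) (w : ℕ → ℝ) : mass S w univ = ∑ x ∈ S, w x := by
  simp [mass]

lemma mass_compl (S : Finset ℕ) (w : ℕ → ℝ) (A : Set ℕ) :
    mass S w Aᶜ = mass S w univ - mass S w A := by
  unfold mass
  rw [← Finset.sum_sub_distrib]
  refine Finset.sum_congr rfl fun x _ => ?_
  by_cases hA : x ∈ A <;> simp [hA]

lemma mass_indicator (S : Finset ℕ) (w : ℕ → ℝ) (A B : Set ℕ) :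
    mass S (A.indicator w) B = mass S w (A ∩ B) := by
  simp only [mass, Set.indicator_indicator, Set.inter_comm]

/-- Some set carries at least half of the variation of a signed measure on `C`. -/
lemma exists_half_le_abs_mass (S : Finset ℕ) (v : ℕ → ℝ) (C : Set ℕ) :
    ∃ P : Set ℕ, mass S (fun x => |v x|) C / 2 ≤ |mass S v (P ∩ C)| := by
  set P : Set ℕ := {x | 0 ≤ v x}
  have key : mass S (fun x => |v x|) C = mass S v (P ∩ C) - mass S v (Pᶜ ∩ C) := by
    unfold mass
    rw [← Finset.sum_sub_distrib]
    refine Finset.sum_congr rfl fun x _ => ?_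
    by_cases hC : x ∈ C <;> by_cases hP : 0 ≤ v x
    · simp [P, hC, hP, abs_of_nonneg]
    · simp [P, hC, hP, abs_of_neg (not_le.1 hP)]
    · simp [hC]
    · simp [hC]
  by_contra! h
  have h1 := (abs_lt.1 (h P)).2
  have h2 := (abs_lt.1 (h Pᶜ)).1
  linarith

/-- A gliding hump argument: a setwise null sequence of finitely supported signed measures
on `ℕ` is null in norm. -/
lemma tendsto_mass_abs_of_setwise {S : ℕ → Finset ℕ} {v : ℕ → ℕ → ℝ}
    (h : ∀ B, Tendsto (fun n => mass (S n) (v n) B) atTop (𝓝 0)) :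
    Tendsto (fun n => mass (S n) (fun x => |v n x|) univ) atTop (𝓝 0) := by
  have hnn : ∀ n A, 0 ≤ mass (S n) (fun x => |v n x|) A :=
    fun n A => mass_nonneg (fun x => abs_nonneg _) A
  have hinit : ∀ k, Tendsto (fun n => mass (S n) (fun x => |v n x|) (Iio k)) atTop (𝓝 0) := by
    intro k
    have hb : Tendsto (fun n => ∑ x ∈ Finset.range k, |mass (S n) (v n) {x}|) atTop (𝓝 0) := by
      have : Tendsto (fun n => ∑ x ∈ Finset.range k, |mass (S n) (v n) {x}|) atTop
          (𝓝 (∑ x ∈ Finset.range k, |(0 : ℝ)|)) :=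
        tendsto_finsetSum _ fun x _ => (h {x}).abs
      simpa using this
    refine squeeze_zero (fun n => hnn n _) (fun n => ?_) hb
    have hs : ∀ x, |mass (S n) (v n) {x}| = if x ∈ S n then |v n x| else 0 := by
      intro x
      have : mass (S n) (v n) {x} = if x ∈ S n then v n x else 0 := by
        simp [mass, Set.indicator_apply, Finset.sum_ite_eq']
      rw [this]; split_ifs <;> simp
    simp only [hs]
    rw [← Finset.sum_filter]
    unfold mass
    simp only [Set.indicator_apply, Set.mem_Iio]
    rw [← Finset.sum_filter]
    refine le_of_eq (Finset.sum_congr ?_ fun _ _ => rfl)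
    ext x; simp [and_comm]
  by_contra hcon
  obtain ⟨ε, hε, hfr⟩ : ∃ ε > 0, ∃ᶠ n in atTop, ε ≤ mass (S n) (fun x => |v n x|) univ := by
    by_contra! hc
    refine hcon (tendsto_order.2 ⟨fun a ha => Eventually.of_forall fun n => ha.trans_le (hnn n _),
      fun a ha => ?_⟩)
    simpa [Filter.not_frequently] using hc a ha
  have hstep : ∀ k : ℕ, ∃ n K, ∃ P : Set ℕ, k ≤ n ∧ k < K ∧ S n ⊆ Finset.range K ∧
      mass (S n) (fun x => |v n x|) (Iio k) < ε / 8 ∧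
      7 * ε / 16 ≤ |mass (S n) (v n) (P ∩ Ici k)| := by
    intro k
    obtain ⟨n, hn, hlt, hkn⟩ := (hfr.and_eventually
      (((hinit k).eventually_lt_const (show (0 : ℝ) < ε / 8 by positivity)).and
        (eventually_ge_atTop k))).exists
    obtain ⟨P, hP⟩ := exists_half_le_abs_mass (S n) (v n) (Ici k)
    obtain ⟨K, hK⟩ := (S n).exists_nat_subset_range
    refine ⟨n, max K (k + 1), P, hkn, by simp, hK.trans (by simp), hlt, ?_⟩
    have hc := mass_compl (S n) (fun x => |v n x|) (Iio k)
    rw [Set.compl_Iio] at hc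
    linarith
  choose N K P hN hK hS hlt hP using hstep
  let k : ℕ → ℕ := fun j => K^[j] 0
  have hks : ∀ j, k (j + 1) = K (k j) := fun j => Function.iterate_succ_apply' K j 0
  have hkm : StrictMono k := strictMono_nat_of_lt_succ fun j => by rw [hks]; exact hK _
  let B : Set ℕ := {x | ∃ j, k j ≤ x ∧ x < k (j + 1) ∧ x ∈ P (k j)}
  have hlow : ∀ j, ε / 4 ≤ |mass (S (N (k j))) (v (N (k j))) B| := by
    intro j
    set n := N (k j)
    have hdiff : |mass (S n) (v n) (P (k j) ∩ Ici (k j)) - mass (S n) (v n) B| ≤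
        mass (S n) (fun x => |v n x|) (Iio (k j)) := by
      unfold mass
      rw [← Finset.sum_sub_distrib]
      refine (Finset.abs_sum_le_sum_abs _ _).trans (Finset.sum_le_sum fun x hx => ?_)
      by_cases hxk : x < k j
      · by_cases hxB : x ∈ B <;> simp [hxB, hxk]
      · have hxB : x ∈ B ↔ x ∈ P (k j) := by
          have hx2 : x < k (j + 1) := by
            rw [hks]; exact Finset.mem_range.1 (hS (k j) hx)
          refine ⟨fun ⟨i, hi1, hi2, hi3⟩ => ?_, fun hp => ⟨j, not_lt.1 hxk, hx2, hp⟩⟩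
          have h1 : i < j + 1 := hkm.lt_iff_lt.1 (hi1.trans_lt hx2)
          have h2 : j < i + 1 := hkm.lt_iff_lt.1 ((not_lt.1 hxk).trans_lt hi2)
          obtain rfl : i = j := by omega
          exact hi3
        by_cases hp : x ∈ P (k j) <;> simp [hxB, hp, hxk, not_lt.1 hxk]
    have h1 := hP (k j)
    have h2 := hlt (k j)
    have h3 := abs_sub_abs_le_abs_sub (mass (S n) (v n) (P (k j) ∩ Ici (k j))) (mass (S n) (v n) B)
    linarith
  have htend : Tendsto (fun j => N (k j)) atTop atTop :=
    tendsto_atTop_mono (fun j => (hkm.id_le j).trans (hN (k j))) tendsto_id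
  have hz := ((h B).abs.comp htend)
  simp only [abs_zero] at hz
  obtain ⟨j, hj⟩ := (hz.eventually_lt_const (show (0 : ℝ) < ε / 4 by positivity)).exists
  exact absurd hj (not_lt.2 (hlow j))

lemma mem_dualFilter_iff {I : Set (Set ℕ)} (hI : IsIdeal I) {A : Set ℕ} :
    A ∈ dualFilter I ↔ Aᶜ ∈ I := by
  obtain ⟨hfin, hmono, hunion, -⟩ := hI
  let G : Filter ℕ :=
    { sets := {A | Aᶜ ∈ I}
      univ_sets := by simpa using hfin ∅ Set.finite_empty
      sets_of_superset := fun {A B} hA hAB => hmono _ _ (Set.compl_subset_compl.2 hAB) hA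
      inter_sets := fun {A B} hA hB => by
        simpa only [Set.mem_ofPred_eq, Set.compl_inter] using hunion _ _ hA hB }
  have hG : G ≤ dualFilter I := (Filter.le_generate_iff).2 fun _ h => h
  exact ⟨fun h => hG h, fun h => Filter.mem_generate_of_mem h⟩

lemma isClopen_iff_of_none_notMem {I : Set (Set ℕ)} (hI : IsIdeal I) {A : Set (Option ℕ)}
    (hA : none ∉ A) : @IsClopen _ (NFTop (dualFilter I)) A ↔ some ⁻¹' A ∈ I := by
  let _ := NFTop (dualFilter I)
  have hopen : IsOpen A := fun h => absurd h hA
  have hcompl : IsOpen Aᶜ ↔ some ⁻¹' A ∈ I := by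
    have : IsOpen Aᶜ ↔ (none ∈ Aᶜ → {n : ℕ | some n ∈ Aᶜ} ∈ dualFilter I) := Iff.rfl
    rw [this, mem_dualFilter_iff hI]
    have hc : {n : ℕ | some n ∈ Aᶜ}ᶜ = some ⁻¹' A := by ext; simp
    rw [hc]
    exact ⟨fun h => h hA, fun h _ => h⟩
  rw [← hcompl, isOpen_compl_iff]
  exact ⟨fun h => h.1, fun h => ⟨h, hopen⟩⟩

lemma sum_option_support (μ : Option ℕ →₀ ℝ) (f : Option ℕ → ℝ) (hf : ∀ x, μ x = 0 → f x = 0) :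
    ∑ x ∈ μ.support, f x = f none + ∑ x ∈ μ.support.eraseNone, f (some x) := by
  have hsub : μ.support ⊆ Finset.insertNone μ.support.eraseNone := by
    intro x hx
    cases x with
    | none => simp
    | some x => simpa using hx
  rw [Finset.sum_subset hsub, Finset.sum_insertNone]
  intro x _ hx
  exact hf x (by simpa using hx)

lemma fsMeas_eq_mass (μ : Option ℕ →₀ ℝ) (A : Set (Option ℕ)) :
    fsMeas μ A = A.indicator μ none +
      mass μ.support.eraseNone (fun x => μ (some x)) (some ⁻¹' A) := by
  unfold fsMeas mass
  rw [sum_option_support]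
  · rfl
  · intro x hx; by_cases h : x ∈ A <;> simp [h, hx]

lemma fsNorm_eq_mass (μ : Option ℕ →₀ ℝ) :
    fsNorm μ = |μ none| + mass μ.support.eraseNone (fun x => |μ (some x)|) univ := by
  unfold fsNorm
  rw [sum_option_support μ (fun x => |μ x|) (by simp +contextual), mass_univ]

/-- Every ideal in `AN` consists of null sets of an unbounded sequence of finitely supported
nonnegative measures. -/
lemma exists_subset_nullSets {I : Set (Set ℕ)} (hI : I ∈ ANclass) :
    ∃ (S : ℕ → Finset ℕ) (w : ℕ → ℕ → ℝ), (∀ n x, 0 ≤ w n x) ∧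
      Tendsto (fun n => mass (S n) (w n) univ) atTop atTop ∧ I ⊆ nullSets S w := by
  obtain ⟨hI, hN⟩ := hI
  obtain ⟨μ, hnorm, hμ⟩ := not_not.1 hN
  refine ⟨fun n => (μ n).support.eraseNone, fun n x => |μ n (some x)|,
    fun n x => abs_nonneg _, ?_, fun A hA => ?_⟩
  · have huniv := (hμ univ (@isClopen_univ _ (NFTop (dualFilter I)))).abs
    simp only [abs_zero] at huniv
    have hlt := huniv.eventually_lt_const (zero_lt_one)
    have h2 : Tendsto (fun n => (fsNorm (μ n) - 1) / 2) atTop atTop :=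
      (tendsto_atTop_add_const_right _ (-1) hnorm).atTop_div_const two_pos
    refine tendsto_atTop_mono' _ (hlt.mono fun n hn => ?_) h2
    rw [fsMeas_eq_mass, Set.indicator_univ, Set.preimage_univ] at hn
    rw [fsNorm_eq_mass]
    have h3 : |mass (μ n).support.eraseNone (fun x => μ n (some x)) univ| ≤
        mass (μ n).support.eraseNone (fun x => |μ n (some x)|) univ := by
      simp only [mass_univ]; exact Finset.abs_sum_le_sum_abs _ _
    have h4 := abs_sub_abs_le_abs_sub (μ n none)
      (-mass (μ n).support.eraseNone (fun x => μ n (some x)) univ)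
    rw [abs_neg, sub_neg_eq_add] at h4
    linarith
  · have hset : ∀ B, Tendsto (fun n => mass (μ n).support.eraseNone
        (A.indicator fun x => μ n (some x)) B) atTop (𝓝 0) := by
      intro B
      have hn : none ∉ some '' (A ∩ B) := by simp
      have hp : some ⁻¹' (some '' (A ∩ B)) = A ∩ B :=
        Set.preimage_image_eq _ (Option.some_injective ℕ)
      have hc := (isClopen_iff_of_none_notMem hI hn).2
        (by rw [hp]; exact hI.2.1 _ _ Set.inter_subset_left hA)
      refine (hμ _ hc).congr fun n => ?_
      rw [fsMeas_eq_mass, Set.indicator_of_notMem hn, zero_add, hp, mass_indicator]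
    refine (tendsto_mass_abs_of_setwise hset).congr fun n => ?_
    unfold mass
    refine Finset.sum_congr rfl fun x _ => ?_
    by_cases hx : x ∈ A <;> simp [hx]

lemma isIdeal_nullSets {S : ℕ → Finset ℕ} {w : ℕ → ℕ → ℝ} (hw : ∀ n x, 0 ≤ w n x)
    (hM : Tendsto (fun n => mass (S n) (w n) univ) atTop atTop)
    (hfin : ∀ A : Set ℕ, A.Finite → A ∈ nullSets S w) : IsIdeal (nullSets S w) := by
  refine ⟨hfin, fun A B hAB hB => ?_, fun A B hA hB => ?_, fun h => ?_⟩
  · exact squeeze_zero (fun n => mass_nonneg (hw n) A) (fun n => mass_mono (hw n) hAB) hB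
  · have h := Tendsto.add hA hB
    rw [add_zero] at h
    exact squeeze_zero (fun n => mass_nonneg (hw n) _) (fun n => mass_union_le (hw n) A B) h
  · exact not_tendsto_nhds_of_tendsto_atTop hM 0 h

lemma nullSets_mem_ANclass {S : ℕ → Finset ℕ} {w : ℕ → ℕ → ℝ} (hw : ∀ n x, 0 ≤ w n x)
    (hM : Tendsto (fun n => mass (S n) (w n) univ) atTop atTop)
    (hfin : ∀ A : Set ℕ, A.Finite → A ∈ nullSets S w) : nullSets S w ∈ ANclass := by
  have hI := isIdeal_nullSets hw hM hfin
  refine ⟨hI, not_not.2 ?_⟩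
  have hex : ∀ n, ∃ μ : Option ℕ →₀ ℝ, μ none = -mass (S n) (w n) univ ∧
      ∀ A, mass μ.support.eraseNone (fun x => μ (some x)) A = mass (S n) (w n) A := by
    intro n
    classical
    let φ : Option ℕ → ℝ := fun x => x.elim (-mass (S n) (w n) univ)
      fun x => if x ∈ S n then w n x else 0
    refine ⟨Finsupp.onFinset (Finset.insertNone (S n)) φ ?_, rfl, fun A => ?_⟩
    · rintro (_ | x) hx
      · simp
      · by_contra h
        exact hx (by simpa [φ] using fun hS => absurd hS (by simpa using h))
    · unfold mass
      refine Finset.sum_subset_zero_on_sdiff ?_ ?_ ?_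
      · intro x hx
        by_contra h
        simp [φ, h] at hx
      · intro x hx
        have h0 : w n x = 0 := by
          have h1 := (Finset.mem_sdiff.1 hx)
          simpa [φ, h1.1] using h1.2
        simp [Set.indicator_apply, h0]
      · intro x hx
        have hS : x ∈ S n := by
          by_contra h
          simp [φ, h] at hx
        simp [Set.indicator_apply, φ, hS]
  choose μ hμn hμ using hex
  have hmeas : ∀ A : Set (Option ℕ), none ∉ A → ∀ n,
      fsMeas (μ n) A = mass (S n) (w n) (some ⁻¹' A) := fun A hA n => by
    rw [fsMeas_eq_mass, Set.indicator_of_notMem hA, zero_add, hμ]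
  refine ⟨μ, ?_, fun A hA => ?_⟩
  · refine tendsto_atTop_mono (fun n => ?_) hM
    rw [fsNorm_eq_mass, hμn, abs_neg]
    exact (le_abs_self _).trans (le_add_of_nonneg_right (mass_nonneg (fun _ => abs_nonneg _) _))
  · by_cases hnA : none ∈ A
    · have hn : none ∉ Aᶜ := fun h => h hnA
      let _ := NFTop (dualFilter (nullSets S w))
      have hc : Tendsto _ _ _ := (isClopen_iff_of_none_notMem hI hn).1 hA.compl
      have hc' := hc.neg
      rw [neg_zero] at hc'
      refine hc'.congr fun n => ?_
      rw [fsMeas_eq_mass, Set.indicator_of_mem hnA, hμn, hμ, Set.preimage_compl, mass_compl]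
      ring
    · have hc : Tendsto _ _ _ := (isClopen_iff_of_none_notMem hI hnA).1 hA
      exact hc.congr fun n => (hmeas A hnA n).symm

/-- Passing to a subsequence, an unbounded sequence of measures may be taken to grow fast
relative to a sequence `g`, which itself grows fast relative to the supports and the norms. -/
lemma exists_fast_growing {I : Set (Set ℕ)} {S : ℕ → Finset ℕ} {w : ℕ → ℕ → ℝ}
    (hw : ∀ n x, 0 ≤ w n x) (hM : Tendsto (fun n => mass (S n) (w n) univ) atTop atTop)
    (hI : I ⊆ nullSets S w) :
    ∃ (S' : ℕ → Finset ℕ) (w' : ℕ → ℕ → ℝ) (g : ℕ → ℕ), (∀ n x, 0 ≤ w' n x) ∧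
      Tendsto (fun n => mass (S' n) (w' n) univ) atTop atTop ∧ I ⊆ nullSets S' w' ∧
      (∀ m, 0 < g m) ∧
      (∀ m : ℕ, (m + 1) * (mass (S' m) (w' m) univ *
        (1 + ∑ n ∈ Finset.range (m + 1), ((S' n).card : ℝ))) ≤ g m) ∧
      ∀ n, 1 ≤ n → ∑ m ∈ Finset.range n, (g m : ℝ) + 2 ≤ mass (S' n) (w' n) univ := by
  let c : ℕ → ℝ := fun k => (k + 1) * (mass (S k) (w k) univ *
    (1 + ∑ n ∈ Finset.range (k + 1), ((S n).card : ℝ)))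
  let h : ℕ → ℕ := fun k => ⌈c k⌉₊ + 1
  have hnext : ∀ k, ∃ l, k < l ∧
      ∑ i ∈ Finset.range (k + 1), (h i : ℝ) + 2 ≤ mass (S l) (w l) univ := fun k =>
    ((eventually_gt_atTop k).and (hM.eventually_ge_atTop _)).exists
  choose next hlt hnext using hnext
  let φ : ℕ → ℕ := fun j => next^[j] 0
  have hφs : ∀ j, φ (j + 1) = next (φ j) := fun j => Function.iterate_succ_apply' next j 0
  have hφ : StrictMono φ := strictMono_nat_of_lt_succ fun j => by rw [hφs]; exact hlt _
  clear_value φ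
  have hsum : ∀ (f : ℕ → ℝ), (∀ i, 0 ≤ f i) → ∀ m,
      ∑ n ∈ Finset.range (m + 1), f (φ n) ≤ ∑ n ∈ Finset.range (φ m + 1), f n := by
    intro f hf m
    rw [← Finset.sum_image (g := φ) (f := f) (fun a _ b _ hab => hφ.injective hab)]
    refine Finset.sum_le_sum_of_subset_of_nonneg (fun x hx => ?_) fun i _ _ => hf i
    obtain ⟨a, ha, rfl⟩ := Finset.mem_image.1 hx
    have := hφ.monotone (Nat.lt_succ_iff.1 (Finset.mem_range.1 ha))
    exact Finset.mem_range.2 (by omega)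
  refine ⟨fun n => S (φ n), fun n => w (φ n), fun n => h (φ n), fun n => hw _,
    hM.comp hφ.tendsto_atTop, fun A hA => (hI hA).comp hφ.tendsto_atTop,
    fun m => Nat.succ_pos _, fun m => ?_, fun n hn => ?_⟩
  · have h1 : c (φ m) ≤ h (φ m) := by
      simp only [h]; push_cast
      exact (Nat.le_ceil _).trans (by linarith)
    refine le_trans ?_ h1
    have h2 : (m : ℝ) ≤ φ m := by exact_mod_cast hφ.id_le m
    have h3 := hsum (fun n => ((S n).card : ℝ)) (fun _ => Nat.cast_nonneg _) m
    have h4 := mass_nonneg (S := S (φ m)) (hw (φ m)) univ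
    simp only [c]
    have h5 : (0 : ℝ) ≤ ∑ n ∈ Finset.range (m + 1), ((S (φ n)).card : ℝ) :=
      Finset.sum_nonneg fun _ _ => Nat.cast_nonneg _
    have h6 : (0 : ℝ) ≤ φ m := Nat.cast_nonneg _
    exact mul_le_mul (by linarith) (mul_le_mul_of_nonneg_left (by linarith) h4)
      (mul_nonneg h4 (by linarith)) (by linarith)
  · obtain ⟨j, rfl⟩ : ∃ j, n = j + 1 := ⟨n - 1, by omega⟩
    have h1 := hnext (φ j)
    rw [← hφs] at h1
    have h2 := hsum (fun n => (h n : ℝ)) (fun _ => Nat.cast_nonneg _) j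
    linarith

/-- A bijective coding of triples of natural numbers. -/
@[irreducible] def tripleCode : ℕ × ℕ × ℕ ≃ ℕ := Denumerable.eqv _

/-- The points coding `(m, x, t)` with `x ∈ S` and `t < k`. -/
def blockSupp (m : ℕ) (S : Finset ℕ) (k : ℕ) : Finset ℕ :=
  (S ×ˢ Finset.range k).map
    ⟨fun p => tripleCode (m, p.1, p.2), fun p q h => by
      have := tripleCode.injective h
      simp only [Prod.mk.injEq] at this
      exact Prod.ext this.2.1 this.2.2⟩

/-- The weights which distribute `w x` evenly among `k` points coding `(m, x, t)`. -/
noncomputable def blockWeight (w : ℕ → ℝ) (k : ℕ) : ℕ → ℝ :=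
  fun y => w (tripleCode.symm y).2.1 / k

lemma blockWeight_nonneg {w : ℕ → ℝ} (hw : ∀ x, 0 ≤ w x) (k x : ℕ) : 0 ≤ blockWeight w k x :=
  div_nonneg (hw _) (Nat.cast_nonneg _)

lemma mass_block (m : ℕ) (S : Finset ℕ) (w : ℕ → ℝ) (k : ℕ) (A : Set ℕ) :
    mass (blockSupp m S k) (blockWeight w k) A =
      ∑ x ∈ S, ∑ t ∈ Finset.range k,
        (tripleCode ⁻¹' A).indicator (fun p => w p.2.1 / k) (m, x, t) := by
  unfold mass blockSupp
  rw [Finset.sum_map, Finset.sum_product]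
  refine Finset.sum_congr rfl fun x _ => Finset.sum_congr rfl fun t _ => ?_
  classical
  simp [Set.indicator_apply, blockWeight]

lemma mass_block_fst {m k : ℕ} (hk : 0 < k) (S : Finset ℕ) (w : ℕ → ℝ) (A : Set ℕ) :
    mass (blockSupp m S k) (blockWeight w k) ((fun y => (tripleCode.symm y).2.1) ⁻¹' A) =
      mass S w A := by
  rw [mass_block]
  refine Finset.sum_congr rfl fun x _ => ?_
  have hk' : (k : ℝ) ≠ 0 := by positivity
  classical
  by_cases hx : x ∈ A
  · simp [hx]
    field_simp
  · simp [hx]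

lemma mass_block_eq_zero {m k : ℕ} {S : Finset ℕ} {w : ℕ → ℝ} {A : Set ℕ}
    (h : ∀ x t, t < k → tripleCode (m, x, t) ∉ A) :
    mass (blockSupp m S k) (blockWeight w k) A = 0 := by
  rw [mass_block]
  refine Finset.sum_eq_zero fun x _ => Finset.sum_eq_zero fun t ht => ?_
  exact Set.indicator_of_notMem (s := tripleCode ⁻¹' A) (h x t (Finset.mem_range.1 ht)) _

lemma mass_block_le_of_slice {m k s : ℕ} {S : Finset ℕ} {w : ℕ → ℝ} (hw : ∀ x, 0 ≤ w x)
    {A : Set ℕ} (h : ∀ x t, tripleCode (m, x, t) ∈ A → t = s) :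
    mass (blockSupp m S k) (blockWeight w k) A ≤ mass S w univ / k := by
  rw [mass_block, mass_univ, Finset.sum_div]
  refine Finset.sum_le_sum fun x _ => ?_
  have hx : 0 ≤ w x / k := div_nonneg (hw x) (Nat.cast_nonneg _)
  calc _ ≤ ∑ t ∈ Finset.range k, if t = s then w x / k else 0 := by
        refine Finset.sum_le_sum fun t _ => ?_
        by_cases ht : t = s
        · rw [if_pos ht]
          exact Set.indicator_apply_le' (fun _ => le_rfl) (fun _ => hx)
        · rw [if_neg ht, Set.indicator_of_notMem (s := tripleCode ⁻¹' A) fun hA => ht (h x t hA)]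
    _ ≤ w x / k := by
        rw [Finset.sum_ite_eq']; split_ifs <;> simp [hx]

lemma mass_le_card_mul {T : Finset ℕ} {u : ℕ → ℝ} {b : ℝ} (hb : 0 ≤ b)
    (hu : ∀ x ∈ T, u x ≤ b) (F : Finset ℕ) :
    mass T u F ≤ F.card * b := by
  classical
  unfold mass
  simp only [Set.indicator_apply, Finset.mem_coe]
  rw [← Finset.sum_filter]
  refine (Finset.sum_le_card_nsmul _ _ b fun x hx => hu x (Finset.mem_filter.1 hx).1).trans ?_
  rw [nsmul_eq_mul]
  gcongr
  exact fun x hx => (Finset.mem_filter.1 hx).2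

lemma blockWeight_le {m k : ℕ} {S : Finset ℕ} {w : ℕ → ℝ} (hw : ∀ x, 0 ≤ w x) :
    ∀ y ∈ blockSupp m S k, blockWeight w k y ≤ mass S w univ / k := by
  intro y hy
  obtain ⟨p, hp, rfl⟩ := Finset.mem_map.1 hy
  have he : blockWeight w k (tripleCode (m, p.1, p.2)) = w p.1 / k := by simp [blockWeight]
  refine he.le.trans ?_
  rw [mass_univ]
  gcongr
  exact Finset.single_le_sum (fun x _ => hw x) (Finset.mem_product.1 hp).1

/-- A set meeting only finitely many blocks is null. -/
lemma mem_nullSets_block_of_bounded {S : ℕ → Finset ℕ} {w : ℕ → ℕ → ℝ} {g : ℕ → ℕ}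
    {A : Set ℕ} {k : ℕ} (hA : ∀ y ∈ A, (tripleCode.symm y).1 ≤ k) :
    A ∈ nullSets (fun m => blockSupp m (S m) (g m)) (fun m => blockWeight (w m) (g m)) := by
  refine tendsto_const_nhds.congr' ((eventually_gt_atTop k).mono fun m hm => ?_)
  refine (mass_block_eq_zero fun x t _ hy => ?_).symm
  have := hA _ hy
  simp only [Equiv.symm_apply_apply] at this
  omega

/-- A pigeonhole principle for the pairs `(c x, d x)` in the region `d x < g (c x)`, `c x < k`. -/
lemma exists_one_le_mass_fiber {S : Finset ℕ} {w : ℕ → ℝ} (hw : ∀ x, 0 ≤ w x) {c d g : ℕ → ℕ}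
    {k : ℕ} {C : Set ℕ} (hC : ∀ x ∈ S, x ∉ C → c x < k ∧ d x < g (c x))
    (hlt : mass S w C + ∑ m ∈ Finset.range k, (g m : ℝ) < mass S w univ) :
    ∃ m t, 1 ≤ mass S w {x | c x = m ∧ d x = t} := by
  by_contra! hcon
  have hle : ∑ m ∈ Finset.range k, ∑ t ∈ Finset.range (g m), mass S w {x | c x = m ∧ d x = t} ≤
      ∑ m ∈ Finset.range k, (g m : ℝ) := by
    refine Finset.sum_le_sum fun m _ => ?_
    refine (Finset.sum_le_card_nsmul _ _ 1 fun t _ => (hcon m t).le).trans ?_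
    simp
  have hswap : ∑ m ∈ Finset.range k, ∑ t ∈ Finset.range (g m),
      mass S w {x | c x = m ∧ d x = t} = ∑ x ∈ S, ∑ m ∈ Finset.range k,
        ∑ t ∈ Finset.range (g m), {x | c x = m ∧ d x = t}.indicator w x := by
    rw [Finset.sum_comm]
    refine Finset.sum_congr rfl fun m _ => ?_
    rw [Finset.sum_comm]
    rfl
  have hcover : mass S w univ ≤ mass S w C + ∑ m ∈ Finset.range k,
      ∑ t ∈ Finset.range (g m), mass S w {x | c x = m ∧ d x = t} := by
    rw [hswap]
    unfold mass
    rw [← Finset.sum_add_distrib]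
    refine Finset.sum_le_sum fun x hx => ?_
    have hnn : ∀ A : Set ℕ, 0 ≤ A.indicator w x := fun A =>
      Set.indicator_nonneg (fun y _ => hw y) x
    have hnn2 : ∀ m ∈ Finset.range k, 0 ≤ ∑ t ∈ Finset.range (g m),
        {x | c x = m ∧ d x = t}.indicator w x := fun m _ => Finset.sum_nonneg fun t _ => hnn _
    rw [Set.indicator_of_mem (Set.mem_univ x)]
    by_cases hxC : x ∈ C
    · rw [Set.indicator_of_mem hxC]
      linarith [Finset.sum_nonneg hnn2]
    obtain ⟨hm, ht⟩ := hC x hx hxC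
    have h1 := Finset.single_le_sum hnn2 (Finset.mem_range.2 hm)
    have h2 := Finset.single_le_sum (f := fun t => {y | c y = c x ∧ d y = t}.indicator w x)
      (fun t _ => hnn _) (Finset.mem_range.2 ht)
    have h3 : {y | c y = c x ∧ d y = d x}.indicator w x = w x :=
      Set.indicator_of_mem (s := {y | c y = c x ∧ d y = d x}) ⟨rfl, rfl⟩ w
    linarith [hnn C]
  linarith

/-- Spreading fast growing measures over large enough blocks gives an ideal which is not
Katětov below any ideal of null sets of the original measures. -/
lemma not_katLE_block {I : Set (Set ℕ)} {S : ℕ → Finset ℕ} {w : ℕ → ℕ → ℝ} {g : ℕ → ℕ}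
    (hw : ∀ n x, 0 ≤ w n x) (hI : I ⊆ nullSets S w) (hg : ∀ m, 0 < g m)
    (hgS : ∀ m : ℕ, (m + 1) * (mass (S m) (w m) univ *
        (1 + ∑ n ∈ Finset.range (m + 1), ((S n).card : ℝ))) ≤ g m)
    (hM : ∀ n, 1 ≤ n → ∑ m ∈ Finset.range n, (g m : ℝ) + 2 ≤ mass (S n) (w n) univ) :
    ¬ KatLE (nullSets (fun m => blockSupp m (S m) (g m)) (fun m => blockWeight (w m) (g m))) I := by
  classical
  rintro ⟨f, hf⟩
  set J := nullSets (fun m => blockSupp m (S m) (g m)) (fun m => blockWeight (w m) (g m))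
  have hnull : ∀ A ∈ J, Tendsto (fun n => mass (S n) (w n) (f ⁻¹' A)) atTop (𝓝 0) :=
    fun A hA => hI (hf A hA)
  have hsmall : ∀ A : Set ℕ, (∀ m : ℕ, mass (blockSupp m (S m) (g m)) (blockWeight (w m) (g m)) A ≤
      1 / ((m : ℝ) + 1)) → A ∈ J := fun A hA =>
    squeeze_zero (fun m => mass_nonneg (blockWeight_nonneg (hw m) _) _) hA
      tendsto_one_div_add_atTop_nhds_zero_nat
  have hbound : ∀ m : ℕ, mass (S m) (w m) univ / g m *
      (1 + ∑ n ∈ Finset.range (m + 1), ((S n).card : ℝ)) ≤ 1 / ((m : ℝ) + 1) := by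
    intro m
    have h1 : (0 : ℝ) < g m := by exact_mod_cast hg m
    rw [div_mul_eq_mul_div, div_le_div_iff₀ h1 (by positivity)]
    linarith [hgS m]
  have hmm : ∀ m, 0 ≤ mass (S m) (w m) univ / g m := fun m =>
    div_nonneg (mass_nonneg (hw m) _) (Nat.cast_nonneg _)
  have hcard : ∀ m, (0 : ℝ) ≤ ∑ n ∈ Finset.range (m + 1), ((S n).card : ℝ) := fun m =>
    Finset.sum_nonneg fun _ _ => Nat.cast_nonneg _
  -- points sent forward, or outside of the blocks
  let F : ℕ → Finset ℕ := fun m => ((Finset.range (m + 1)).biUnion S).image f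
  let A₀ : Set ℕ := {z | g (tripleCode.symm z).1 ≤ (tripleCode.symm z).2.2}
  let A₁ : Set ℕ := {z | z ∈ F (tripleCode.symm z).1}
  have hA₀ : A₀ ∈ J := by
    refine hsmall _ fun m => ?_
    rw [mass_block_eq_zero]
    · positivity
    · intro x t ht
      simpa [A₀] using ht
  have hA₁ : A₁ ∈ J := by
    refine hsmall _ fun m => ?_
    have hsub : mass (blockSupp m (S m) (g m)) (blockWeight (w m) (g m)) A₁ ≤
        mass (blockSupp m (S m) (g m)) (blockWeight (w m) (g m)) (F m) := by
      rw [mass_block, mass_block]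
      refine Finset.sum_le_sum fun x _ => Finset.sum_le_sum fun t _ => le_of_eq ?_
      simp [Set.indicator_apply, A₁]
    refine hsub.trans ((mass_le_card_mul (hmm m) (blockWeight_le (hw m)) (F m)).trans
      (le_trans ?_ (hbound m)))
    rw [mul_comm]
    gcongr
    · exact hmm m
    have h1 : (F m).card ≤ ∑ n ∈ Finset.range (m + 1), (S n).card :=
      Finset.card_image_le.trans Finset.card_biUnion_le
    have h2 : ((F m).card : ℝ) ≤ ∑ n ∈ Finset.range (m + 1), ((S n).card : ℝ) := by
      exact_mod_cast h1
    linarith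
  let slice : ℕ → ℕ → Set ℕ := fun m t =>
    {z | (tripleCode.symm z).1 = m ∧ (tripleCode.symm z).2.2 = t}
  have hpigeon : ∀ᶠ n in atTop, ∃ m t, 1 ≤ mass (S n) (w n) (f ⁻¹' slice m t) := by
    have h0 := (hnull A₀ hA₀).eventually_lt_const (show (0 : ℝ) < 1 / 2 by norm_num)
    have h1 := (hnull A₁ hA₁).eventually_lt_const (show (0 : ℝ) < 1 / 2 by norm_num)
    filter_upwards [h0, h1, eventually_ge_atTop 1] with n h0 h1 hn
    refine exists_one_le_mass_fiber (hw n) (C := f ⁻¹' (A₀ ∪ A₁)) (fun x hx hxC => ?_) (k := n)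
      (g := g) ?_
    · rw [Set.mem_preimage, Set.mem_union, not_or] at hxC
      refine ⟨?_, not_le.1 hxC.1⟩
      by_contra! hle
      refine hxC.2 (Finset.mem_image.2 ⟨x, Finset.mem_biUnion.2 ⟨n, ?_, hx⟩, rfl⟩)
      exact Finset.mem_range.2 (Nat.lt_succ_iff.2 hle)
    · have h2 := mass_union_le (S := S n) (hw n) (f ⁻¹' A₀) (f ⁻¹' A₁)
      rw [← Set.preimage_union] at h2
      linarith [hM n hn]
  obtain ⟨n₀, hn₀⟩ := eventually_atTop.1 hpigeon
  have hpig : ∀ n, ∃ m t, n₀ ≤ n → 1 ≤ mass (S n) (w n) (f ⁻¹' slice m t) := by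
    intro n
    by_cases hn : n₀ ≤ n
    · obtain ⟨m, t, h⟩ := hn₀ n hn
      exact ⟨m, t, fun _ => h⟩
    · exact ⟨0, 0, fun h => absurd h hn⟩
  choose M T hMT using hpig
  have hMtend : Tendsto M atTop atTop := by
    refine tendsto_atTop.2 fun k => ?_
    have hk : {z : ℕ | (tripleCode.symm z).1 ≤ k} ∈ J :=
      mem_nullSets_block_of_bounded fun y hy => hy
    filter_upwards [(hnull _ hk).eventually_lt_const zero_lt_one, eventually_ge_atTop n₀]
      with n h1 h2
    by_contra! hlt
    refine absurd (hMT n h2) (not_le.2 (lt_of_le_of_lt (mass_mono (hw n) ?_) h1))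
    rintro x ⟨hx, -⟩
    exact hx.le.trans hlt.le
  obtain ⟨ψ, hψ, hMψ⟩ := strictMono_subseq_of_tendsto_atTop hMtend
  let A : Set ℕ := ⋃ j, slice (M (ψ j)) (T (ψ j))
  have hA : A ∈ J := by
    refine hsmall A fun m => ?_
    have hs : ∃ s, ∀ x t, tripleCode (m, x, t) ∈ A → t = s := by
      by_cases hm : ∃ j, M (ψ j) = m
      · obtain ⟨j, rfl⟩ := hm
        refine ⟨T (ψ j), fun x t h => ?_⟩
        obtain ⟨i, hi1, hi2⟩ := Set.mem_iUnion.1 h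
        simp only [Equiv.symm_apply_apply] at hi1 hi2
        rw [hi2, hMψ.injective hi1]
      · refine ⟨0, fun x t h => ?_⟩
        obtain ⟨i, hi1, -⟩ := Set.mem_iUnion.1 h
        simp only [Equiv.symm_apply_apply] at hi1
        exact absurd ⟨i, hi1.symm⟩ hm
    obtain ⟨s, hs⟩ := hs
    refine (mass_block_le_of_slice (hw m) hs).trans (le_trans ?_ (hbound m))
    exact le_mul_of_one_le_right (hmm m) (by linarith [hcard m])
  have hlim := (hnull A hA).comp hψ.tendsto_atTop
  obtain ⟨j, hj1, hj2⟩ := ((hlim.eventually_lt_const zero_lt_one).and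
    (hψ.tendsto_atTop.eventually_ge_atTop n₀)).exists
  refine absurd (hMT (ψ j) hj2) (not_le.2 (lt_of_le_of_lt (mass_mono (hw _) ?_) hj1))
  exact Set.preimage_mono (Set.subset_iUnion (fun j => slice (M (ψ j)) (T (ψ j))) j)

lemma exists_katetov_above {I : Set (Set ℕ)} (hI : I ∈ ANclass) :
    ∃ J ∈ ANclass, KatLE I J ∧ ¬ KatLE J I := by
  obtain ⟨S₀, w₀, hw₀, hM₀, hI₀⟩ := exists_subset_nullSets hI
  obtain ⟨S, w, g, hw, hM, hIS, hg, hgS, hMg⟩ := exists_fast_growing hw₀ hM₀ hI₀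
  refine ⟨nullSets (fun m => blockSupp m (S m) (g m)) (fun m => blockWeight (w m) (g m)),
    nullSets_mem_ANclass (fun n => blockWeight_nonneg (hw n) _) ?_ fun A hA => ?_,
    ⟨fun y => (tripleCode.symm y).2.1, fun A hA => ?_⟩, not_katLE_block hw hIS hg hgS hMg⟩
  · exact hM.congr fun m => (mass_block_fst (hg m) (S m) (w m) univ).symm
  · obtain ⟨k, hk⟩ := (hA.image fun y => (tripleCode.symm y).1).bddAbove
    exact mem_nullSets_block_of_bounded fun y hy => hk (Set.mem_image_of_mem _ hy)
  · exact (hIS hA).congr fun m => (mass_block_fst (hg m) (S m) (w m) A).symm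

/-- Theorem `thm_no_maximal`. For every ideal `I ∈ AN` there is `J ∈ AN` with
`I <_K J`; consequently `AN` has no `≤_K`-maximal element. -/
theorem AN_no_katetov_maximal :
    (∀ I ∈ ANclass, ∃ J ∈ ANclass, KatLE I J ∧ ¬ KatLE J I) ∧
      ¬ ∃ I ∈ ANclass, ∀ J ∈ ANclass, KatLE I J → KatLE J I := by
  refine ⟨fun I hI => exists_katetov_above hI, ?_⟩
  rintro ⟨I, hI, hmax⟩
  obtain ⟨J, hJ, hIJ, hJI⟩ := exists_katetov_above hI
  exact hJI (hmax J hJ hIJ)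
end

section
/- Let I and J be ideals on ω. If I ≤_K J and J is a P-ideal, then I ≤_KB J, i.e., there is a finite-to-one function f : ℕ → ℕ with f⁻¹[A] ∈ J for every A ∈ I. -/
open Filter Topology Set MeasureTheory
open scoped ENNReal NNReal

/-- Lemma `katetov_blass`. If `I ≤_K J` and `J` is a P-ideal, then `I ≤_KB J`:
there is a finite-to-one Katětov reduction. -/
theorem katetov_to_katetovBlass (I J : Set (Set ℕ))
    (hI : IsIdeal I) (hJ : IsIdeal J) (hP : IsPIdeal J)
    (h : KatLE I J) :
    ∃ f : ℕ → ℕ, (∀ m : ℕ, (f ⁻¹' {m}).Finite) ∧ ∀ A ∈ I, f ⁻¹' A ∈ J := by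
  classical
  obtain ⟨-, hsub, hunion, -⟩ := hJ
  obtain ⟨f, hf⟩ := h
  obtain ⟨B, hB, hfB⟩ := hP (fun n => f ⁻¹' {n}) fun n => hf _ (hI.1 _ (finite_singleton n))
  refine ⟨fun n => if n ∈ B then n else f n, fun m => ?_, fun A hA => ?_⟩
  · refine ((hfB m).union (finite_singleton m)).subset fun n hn => ?_
    by_cases hnB : n ∈ B <;> simp_all
  · refine hsub _ _ (fun n hn => ?_) (hunion _ _ (hf A hA) hB)
    by_cases hnB : n ∈ B <;> simp_all
end

section
/- Let F and G be free filters on ω. If F ≤_K G and G does not have the Nikodym property, then F does not have the Nikodym property. -/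
open Filter Topology Set MeasureTheory
open scoped ENNReal NNReal

theorem fsMeas_eq_linearCombination (μ : Option ℕ →₀ ℝ) (A : Set (Option ℕ)) :
    fsMeas μ A = Finsupp.linearCombination ℝ (A.indicator (fun _ => (1 : ℝ))) μ := by
  classical
  simp [fsMeas, Finsupp.linearCombination_apply, Finsupp.sum, Set.indicator_apply]

/-- Schur's theorem for finitely supported functions: setwise convergence to zero implies
convergence to zero in the `ℓ¹` norm. -/
theorem tendsto_sum_abs_of_tendsto_sum_indicator {α : Type*} (c : ℕ → (α →₀ ℝ))
    (h : ∀ B : Set α,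
      Tendsto (fun n => ∑ x ∈ (c n).support, B.indicator (c n) x) atTop (nhds 0)) :
    Tendsto (fun n => ∑ x ∈ (c n).support, |c n x|) atTop (nhds 0) := by
  classical
  have h_point (x : α) : Tendsto (fun n => c n x) atTop (nhds 0) := by
    refine (h {x}).congr fun n => ?_
    simp only [Set.indicator_apply, Set.mem_singleton_iff, Finset.sum_ite_eq',
      Finsupp.mem_support_iff]
    split_ifs with hx
    · rfl
    · exact (not_not.mp hx).symm
  let m (n : ℕ) (b : α → Bool) : ℝ := ∑ x ∈ (c n).support, if b x then c n x else 0
  have hm_cont (n : ℕ) : Continuous (m n) := by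
    refine continuous_finsetSum _ fun x _ => ?_
    exact (continuous_of_discreteTopology (f := fun t : Bool => if t then c n x else 0)).comp
      (continuous_apply x)
  have hm (b : α → Bool) : Tendsto (fun n => m n b) atTop (nhds 0) := by
    refine (h {x | b x = true}).congr fun n => ?_
    simp [m, Set.indicator_apply]
  have hnonneg (n : ℕ) : 0 ≤ ∑ x ∈ (c n).support, |c n x| :=
    Finset.sum_nonneg fun _ _ => abs_nonneg _
  rw [Metric.tendsto_atTop]
  intro ε hε
  obtain ⟨δ, hδ, hδε⟩ : ∃ δ > 0, 5 * δ < ε := ⟨ε / 6, by linarith, by linarith⟩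
  obtain ⟨N, b₀, hb₀⟩ : ∃ N : ℕ, (interior {b : α → Bool | ∀ n ≥ N, |m n b| ≤ δ}).Nonempty := by
    refine nonempty_interior_of_iUnion_of_closed (fun N => ?_) ?_
    · simp only [Set.ofPred_forall]
      exact isClosed_iInter fun n => isClosed_iInter fun _ =>
        isClosed_le (hm_cont n).abs continuous_const
    · refine Set.eq_univ_of_forall fun b => Set.mem_iUnion.2 ?_
      obtain ⟨N, hN⟩ := Metric.tendsto_atTop.1 (hm b) δ hδ
      exact ⟨N, fun n hn => by simpa using (hN n hn).le⟩
  obtain ⟨I, u, hu, hI⟩ := isOpen_pi_iff.1 isOpen_interior b₀ hb₀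
  have hagree (b : α → Bool) (hb : ∀ x ∈ I, b x = b₀ x) (n : ℕ) (hn : N ≤ n) : |m n b| ≤ δ :=
    interior_subset (hI fun x hx => by rw [hb x hx]; exact (hu x hx).2) n hn
  have hoff (D : Set α) (n : ℕ) (hn : N ≤ n) :
      |∑ x ∈ (c n).support, if x ∉ I ∧ x ∈ D then c n x else 0| ≤ 2 * δ := by
    have h₁ := hagree (fun x => if x ∈ I then b₀ x else decide (x ∈ D))
      (fun x hx => by simp [hx]) n hn
    have h₂ := hagree (fun x => if x ∈ I then b₀ x else false) (fun x hx => by simp [hx]) n hn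
    have hdiff : (∑ x ∈ (c n).support, if x ∉ I ∧ x ∈ D then c n x else 0) =
        m n (fun x => if x ∈ I then b₀ x else decide (x ∈ D)) -
          m n (fun x => if x ∈ I then b₀ x else false) := by
      simp only [m, ← Finset.sum_sub_distrib]
      refine Finset.sum_congr rfl fun x _ => ?_
      by_cases hx : x ∈ I <;> simp [hx]
    rw [hdiff]
    exact (abs_sub _ _).trans (by linarith)
  have hI_small : Tendsto (fun n => ∑ x ∈ I, |c n x|) atTop (nhds 0) := by
    simpa using tendsto_finsetSum I fun x _ => (h_point x).abs
  obtain ⟨M, hM⟩ := Metric.tendsto_atTop.1 hI_small δ hδ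
  refine ⟨max N M, fun n hn => ?_⟩
  rw [Real.dist_eq, sub_zero, abs_of_nonneg (hnonneg n)]
  have h₁ := hoff {x | 0 ≤ c n x} n (le_of_max_le_left hn)
  have h₂ := hoff {x | c n x < 0} n (le_of_max_le_left hn)
  have h₃ := hM n (le_of_max_le_right hn)
  rw [Real.dist_eq, sub_zero] at h₃
  have h₄ : ∑ x ∈ (c n).support, |c n x| ≤ ∑ x ∈ I, |c n x| +
      ((∑ x ∈ (c n).support, if x ∉ I ∧ x ∈ {x | 0 ≤ c n x} then c n x else 0) -
        ∑ x ∈ (c n).support, if x ∉ I ∧ x ∈ {x | c n x < 0} then c n x else 0) := by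
    have h₅ : ∑ x ∈ (c n).support, (if x ∈ I then |c n x| else 0) ≤ ∑ x ∈ I, |c n x| := by
      rw [← Finset.sum_filter]
      exact Finset.sum_le_sum_of_subset_of_nonneg (fun x hx => (Finset.mem_filter.1 hx).2)
        fun _ _ _ => abs_nonneg _
    refine le_trans (le_of_eq ?_) (add_le_add_left h₅ _)
    rw [← Finset.sum_sub_distrib, ← Finset.sum_add_distrib]
    refine Finset.sum_congr rfl fun x _ => ?_
    by_cases hx : x ∈ I
    · simp [hx]
    · rcases le_or_gt 0 (c n x) with hc | hc
      · simp [hx, hc, abs_of_nonneg hc, not_lt.2 hc]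
      · simp [hx, hc, abs_of_neg hc, not_le.2 hc]
  linarith [(abs_le.1 h₁).2, (abs_le.1 h₂).1, (abs_lt.1 h₃).2]

theorem isClopen_NFTop_of_none_notMem {F : Filter ℕ} {A : Set (Option ℕ)} (hA : none ∉ A)
    (hF : {n : ℕ | some n ∉ A} ∈ F) : @IsClopen _ (NFTop F) A :=
  letI := NFTop F
  ⟨⟨fun _ => hF⟩, fun h => absurd h hA⟩

theorem IsANSeq.tendsto_fsRestrNorm {F : Filter ℕ} {μ : ℕ → (Option ℕ →₀ ℝ)}
    (hμ : IsANSeq F μ) {A : Set (Option ℕ)} (hA : none ∉ A) (hF : {n : ℕ | some n ∉ A} ∈ F) :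
    Tendsto (fun n => fsRestrNorm (μ n) A) atTop (nhds 0) := by
  classical
  have key := tendsto_sum_abs_of_tendsto_sum_indicator
    (fun n => (μ n).filter (· ∈ A)) fun B => ?_
  · refine key.congr fun n => ?_
    simp only [fsRestrNorm, Finsupp.support_filter, Finset.sum_filter, Set.indicator_apply]
    refine Finset.sum_congr rfl fun x _ => ?_
    by_cases hx : x ∈ A <;> simp [hx]
  · refine (hμ.2 (A ∩ B) (isClopen_NFTop_of_none_notMem (fun h => hA h.1) ?_)).congr fun n => ?_
    · exact Filter.mem_of_superset hF fun n hn h => hn h.1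
    · simp only [fsMeas, Finsupp.support_filter, Finset.sum_filter, Set.indicator_apply]
      refine Finset.sum_congr rfl fun x _ => ?_
      by_cases hx : x ∈ A <;> simp [hx]

/-- The image of `|μ|` under the extension of `f` to `Option ℕ` fixing `none`, corrected by a
multiple of the point mass at `none` so as to have total mass zero. -/
noncomputable def balancedMap (f : ℕ → ℕ) (μ : Option ℕ →₀ ℝ) : Option ℕ →₀ ℝ :=
  ∑ x ∈ μ.support, |μ x| • (Finsupp.single (x.map f) 1 - Finsupp.single none 1)

theorem fsMeas_balancedMap (f : ℕ → ℕ) (μ : Option ℕ →₀ ℝ) (A : Set (Option ℕ)) :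
    fsMeas (balancedMap f μ) A = ∑ x ∈ μ.support,
      |μ x| * (A.indicator (fun _ => 1) (x.map f) - A.indicator (fun _ => 1) none) := by
  simp [fsMeas_eq_linearCombination, balancedMap, map_sum]

theorem fsMeas_balancedMap_of_none_notMem (f : ℕ → ℕ) (μ : Option ℕ →₀ ℝ)
    {A : Set (Option ℕ)} (hA : none ∉ A) :
    fsMeas (balancedMap f μ) A = fsRestrNorm μ (Option.map f ⁻¹' A) := by
  classical
  simp [fsMeas_balancedMap, fsRestrNorm, Set.indicator_apply, hA]

theorem fsMeas_balancedMap_compl (f : ℕ → ℕ) (μ : Option ℕ →₀ ℝ) (A : Set (Option ℕ)) :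
    fsMeas (balancedMap f μ) Aᶜ = -fsMeas (balancedMap f μ) A := by
  classical
  rw [fsMeas_balancedMap, fsMeas_balancedMap, ← Finset.sum_neg_distrib]
  refine Finset.sum_congr rfl fun x _ => ?_
  by_cases h₁ : x.map f ∈ A <;> by_cases h₂ : none ∈ A <;> simp [h₁, h₂]

theorem abs_apply_le_fsNorm (μ : Option ℕ →₀ ℝ) (x : Option ℕ) : |μ x| ≤ fsNorm μ := by
  by_cases hx : x ∈ μ.support
  · exact Finset.single_le_sum (f := fun x => |μ x|) (fun _ _ => abs_nonneg _) hx
  · rw [Finsupp.notMem_support_iff.1 hx, abs_zero]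
    exact Finset.sum_nonneg fun _ _ => abs_nonneg _

theorem fsNorm_le_fsNorm_balancedMap (f : ℕ → ℕ) (μ : Option ℕ →₀ ℝ) :
    fsNorm μ ≤ 2 * fsNorm (balancedMap f μ) + |fsMeas μ Set.univ| := by
  classical
  have hnone : balancedMap f μ none = -∑ x ∈ μ.support.erase none, |μ x| := by
    rw [balancedMap, Finsupp.finsetSum_apply, ← Finset.sum_neg_distrib]
    rw [← Finset.sum_erase (a := none) _ (by simp)]
    refine Finset.sum_congr rfl fun x hx => ?_
    obtain ⟨k, rfl⟩ := Option.ne_none_iff_exists'.1 (Finset.ne_of_mem_erase hx)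
    simp
  have h₁ : ∑ x ∈ μ.support.erase none, |μ x| ≤ fsNorm (balancedMap f μ) := by
    refine le_trans ?_ (abs_apply_le_fsNorm _ none)
    rw [hnone, abs_neg]
    exact le_abs_self _
  have h₂ : fsNorm μ = |μ none| + ∑ x ∈ μ.support.erase none, |μ x| := by
    by_cases h : none ∈ μ.support
    · exact (Finset.add_sum_erase _ (fun x => |μ x|) h).symm
    · rw [Finset.erase_eq_of_notMem h, Finsupp.notMem_support_iff.1 h, abs_zero, zero_add, fsNorm]
  have h₃ : fsMeas μ Set.univ = μ none + ∑ x ∈ μ.support.erase none, μ x := by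
    simp only [fsMeas, Set.indicator_univ]
    by_cases h : none ∈ μ.support
    · exact (Finset.add_sum_erase _ (fun x => μ x) h).symm
    · rw [Finset.erase_eq_of_notMem h, Finsupp.notMem_support_iff.1 h, zero_add]
  have h₄ := Finset.abs_sum_le_sum_abs (fun x => μ x) (μ.support.erase none)
  have h₅ : |μ none| ≤ |fsMeas μ Set.univ| + |∑ x ∈ μ.support.erase none, μ x| := by
    rw [show μ none = fsMeas μ Set.univ - ∑ x ∈ μ.support.erase none, μ x by rw [h₃]; ring]
    exact abs_sub _ _
  linarith

theorem IsANSeq.comp_balancedMap {F G : Filter ℕ} {f : ℕ → ℕ} (hf : ∀ B ∈ F, f ⁻¹' B ∈ G)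
    {μ : ℕ → (Option ℕ →₀ ℝ)} (hμ : IsANSeq G μ) :
    IsANSeq F (fun n => balancedMap f (μ n)) := by
  have hnotMem (A : Set (Option ℕ)) (hA : @IsClopen _ (NFTop F) A) (hnone : none ∉ A) :
      Tendsto (fun n => fsMeas (balancedMap f (μ n)) A) atTop (nhds 0) := by
    simp only [fsMeas_balancedMap_of_none_notMem f _ hnone]
    refine hμ.tendsto_fsRestrNorm hnone ?_
    exact hf _ ((@IsClosed.isOpen_compl _ (NFTop F) A hA.1) hnone)
  refine ⟨?_, fun A hA => ?_⟩
  · have hzero : Tendsto (fun n => |fsMeas (μ n) Set.univ|) atTop (nhds 0) := by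
      simpa using (hμ.2 Set.univ (@isClopen_univ _ (NFTop G))).abs
    have hdiff := (hμ.1.atTop_add hzero.neg).atTop_div_const (zero_lt_two' ℝ)
    refine tendsto_atTop_mono (fun n => ?_) hdiff
    linarith [fsNorm_le_fsNorm_balancedMap f (μ n)]
  · by_cases hnone : none ∈ A
    · have h := (hnotMem Aᶜ (@IsClopen.compl _ (NFTop F) A hA) fun h => h hnone).neg
      simpa [fsMeas_balancedMap_compl] using h
    · exact hnotMem A hA hnone

/-- Proposition `katetov_nikodym`. If `F ≤_K G` and `G` does not have the
Nikodym property, then `F` does not have the Nikodym property. -/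
theorem katetov_transfers_not_nikodym (F G : Filter ℕ)
    (hFfree : F ≤ Filter.cofinite) (hFne : F.NeBot)
    (hGfree : G ≤ Filter.cofinite) (hGne : G.NeBot)
    (hK : ∃ f : ℕ → ℕ, ∀ B ∈ F, f ⁻¹' B ∈ G)
    (hG : ¬ HasNikodymProp G) :
    ¬ HasNikodymProp F := by
  obtain ⟨f, hf⟩ := hK
  obtain ⟨μ, hμ⟩ := not_not.1 hG
  exact not_not.2 ⟨_, hμ.comp_balancedMap hf⟩
end
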